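/- arXiv:1410.7437 — 3 statements merged into one kernel-verified Lean document; each statement's English description precedes it below -/
import Mathlib

section
/- For every integer d ≥ 1, every integer in the interval [0, 4^{d+1}] belongs to the 4-fold sumset S(d,d-1)+S(d,d-1)+S(d,d-1)+S(d,d-1), and this 4-fold sumset is contained in S(d+2,d-1). -/
/-- The field with four elements. -/
abbrev F4 : Type := GaloisField 2 2

/-- The points of the projective space `PG_d(4)` : one-dimensional subspaces of `F4^(d+1)`. -/
abbrev PGPoint (d : ℕ) := Projectivization F4 (Fin (d + 1) → F4)

/-- The set of projective points lying in a given linear subspace `W` of `F4^(d+1)`. -/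
def pointsIn {d : ℕ} (W : Submodule F4 (Fin (d + 1) → F4)) : Set (PGPoint d) :=
  {p | p.submodule ≤ W}

/-- A line of `PG_d(4)` : the set of points contained in some 2-dimensional linear subspace. -/
def IsLine {d : ℕ} (L : Set (PGPoint d)) : Prop :=
  ∃ W : Submodule F4 (Fin (d + 1) → F4), Module.finrank F4 W = 2 ∧ L = pointsIn W

/-- `LegalTrunc D` : removing the point set `D` from `PG_d(4)` is a legal truncation,
i.e. no line has exactly two points outside `D`. -/
def LegalTrunc {d : ℕ} (D : Set (PGPoint d)) : Prop :=
  ∀ L : Set (PGPoint d), IsLine L → (L \ D).ncard ≠ 2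

/-- `bracket4 e = [e]₄ = 1 + 4 + 4² + ⋯ + 4^e`. -/
def bracket4 (e : ℕ) : ℕ := ∑ i ∈ Finset.range (e + 1), 4 ^ i

/-- `TT d i` (the set `T(d,i)` of the paper): the set of integers `n` such that `PG_d(4)`
admits a legal truncation removing `n` points, in which some hyperplane `H` has
removed-point set exactly the point set of a copy of `PG_i(4)` contained in `H`. -/
def TT (d i : ℕ) : Set ℕ :=
  {n | ∃ D : Set (PGPoint d), LegalTrunc D ∧ D.ncard = n ∧
    ∃ H W : Submodule F4 (Fin (d + 1) → F4),
      Module.finrank F4 H = d ∧ Module.finrank F4 W = i + 1 ∧ W ≤ H ∧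
        D ∩ pointsIn H = pointsIn W}

/-- `SS d i = S(d,i) = T(d,i) - [i]₄` (every element of `T(d,i)` is at least `[i]₄`). -/
def SS (d i : ℕ) : Set ℕ := {m | m + bracket4 i ∈ TT d i}

section Field

instance : Finite F4 := Nat.finite_of_card_ne_zero (by rw [GaloisField.card 2 2 (by norm_num)]; norm_num)

theorem F4.natCard : Nat.card F4 = 4 := by
  rw [GaloisField.card 2 2 (by norm_num)]; norm_num

theorem F4.add_self (x : F4) : x + x = 0 := CharTwo.add_self_eq_zero x

/-- A primitive cube root of unity in `F4`, together with the list of elements of `F4`. -/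
theorem F4.exists_primitive :
    ∃ w : F4, w ≠ 0 ∧ w ≠ 1 ∧ w * w = w + 1 ∧ ∀ t : F4, t = 0 ∨ t = 1 ∨ t = w ∨ t = w + 1 := by
  classical
  have : Fintype F4 := Fintype.ofFinite F4
  have hc : Fintype.card F4 = 4 := by rw [← Nat.card_eq_fintype_card, F4.natCard]
  obtain ⟨w, hw⟩ : ∃ w, w ∉ ({0, 1} : Finset F4) := by
    by_contra! h
    have h1 := Finset.card_le_card (fun x _ => h x : (Finset.univ : Finset F4) ⊆ {0, 1})
    have h2 := Finset.card_le_two (a := (0 : F4)) (b := 1)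
    rw [Finset.card_univ] at h1
    omega
  simp only [Finset.mem_insert, Finset.mem_singleton, not_or] at hw
  obtain ⟨h0, h1⟩ := hw
  have e1 : w + 1 ≠ 0 := fun h => h1 (CharTwo.add_eq_zero.mp h)
  have hall : ∀ t : F4, t = 0 ∨ t = 1 ∨ t = w ∨ t = w + 1 := by
    have h4 : ({0, 1, w, w + 1} : Finset F4).card = 4 := by
      rw [Finset.card_insert_of_notMem, Finset.card_insert_of_notMem,
        Finset.card_insert_of_notMem, Finset.card_singleton] <;>
      simp [h0, Ne.symm h0, Ne.symm h1, Ne.symm e1]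
    have hu := (Finset.card_eq_iff_eq_univ _).mp (h4.trans hc.symm)
    intro t
    have := Finset.mem_univ t
    rw [← hu] at this
    simpa using this
  refine ⟨w, h0, h1, ?_, hall⟩
  rcases hall (w * w) with h | h | h | h
  · simp [h0] at h
  · exact absurd (by linear_combination h - F4.add_self w + F4.add_self 1 : (w - 1) * (w - 1) = 0)
      (by simp [sub_eq_zero, h1])
  · exact absurd (mul_left_cancel₀ h0 (h.trans (mul_one w).symm)) h1
  · exact h

end Field

section Legality

/-- A set of points of an affine space over `F4` meeting no line in exactly two points. -/
def AffineLegal {A : Type*} [AddCommGroup A] [Module F4 A] (X : Set A) : Prop :=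
  ∀ x ∈ X, ∀ y ∈ X, x ≠ y → ∃ t : F4, t ≠ 0 ∧ t ≠ 1 ∧ x + t • (y - x) ∈ X

theorem AffineLegal.compl {A : Type*} [AddCommGroup A] [Module F4 A] {X : Set A}
    (hX : AffineLegal X) : AffineLegal Xᶜ := by
  obtain ⟨w, h0, h1, -, hall⟩ := F4.exists_primitive
  intro x hx y hy hxy
  by_contra! h
  simp only [Set.mem_compl_iff, not_not] at h
  have e1 : w + 1 ≠ 0 := fun h => h1 (CharTwo.add_eq_zero.mp h)
  have m1 := h w h0 h1
  have m2 := h (w + 1) e1 (by simpa using h0)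
  obtain ⟨t, t0, t1, ht⟩ := hX _ m1 _ m2 (by
    intro e
    rw [add_smul, one_smul] at e
    have : y - x = 0 := by simpa using e
    exact hxy (sub_eq_zero.mp this).symm)
  have e : x + w • (y - x) + t • (x + (w + 1) • (y - x) - (x + w • (y - x))) =
      x + (w + t) • (y - x) := by module
  rw [e] at ht
  rcases hall t with rfl | rfl | rfl | rfl
  · exact t0 rfl
  · exact t1 rfl
  · rw [F4.add_self] at ht
    exact hx (by simpa using ht)
  · rw [← add_assoc, F4.add_self] at ht
    exact hy (by simpa using ht)

variable {d : ℕ}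

theorem mk_mem_pointsIn {W : Submodule F4 (Fin (d + 1) → F4)} {v : Fin (d + 1) → F4} (hv : v ≠ 0) :
    (Projectivization.mk F4 v hv : PGPoint d) ∈ pointsIn W ↔ v ∈ W := by
  simp [pointsIn, Projectivization.submodule_mk, Submodule.span_singleton_le_iff_mem]

theorem legalTrunc_of_forall {D : Set (PGPoint d)}
    (h : ∀ (u v : Fin (d + 1) → F4) (hu : u ≠ 0) (hv : v ≠ 0),
      Projectivization.mk F4 u hu ∉ D → Projectivization.mk F4 v hv ∉ D → (∀ k : F4, v ≠ k • u) →
      ∃ a b : F4, a ≠ 0 ∧ b ≠ 0 ∧ ∃ hw : a • u + b • v ≠ 0,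
        Projectivization.mk F4 (a • u + b • v) hw ∉ D) : LegalTrunc D := by
  rintro L ⟨W, -, rfl⟩ hc
  obtain ⟨p, q, hpq, hL⟩ := Set.ncard_eq_two.mp hc
  induction p using Projectivization.ind with
  | _ u hu =>
  induction q using Projectivization.ind with
  | _ v hv =>
  have hp : Projectivization.mk F4 u hu ∈ pointsIn W \ D := by simp [hL]
  have hq : Projectivization.mk F4 v hv ∈ pointsIn W \ D := by simp [hL]
  have huv : ∀ k : F4, v ≠ k • u := fun k hk =>
    hpq ((Projectivization.mk_eq_mk_iff' F4 v u hv hu).mpr ⟨k, hk.symm⟩).symm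
  obtain ⟨a, b, ha, hb, hw, hwD⟩ := h u v hu hv hp.2 hq.2 huv
  have hr : Projectivization.mk F4 (a • u + b • v) hw ∈ pointsIn W \ D :=
    ⟨(mk_mem_pointsIn hw).mpr (W.add_mem (W.smul_mem _ ((mk_mem_pointsIn hu).mp hp.1))
      (W.smul_mem _ ((mk_mem_pointsIn hv).mp hq.1))), hwD⟩
  rw [hL] at hr
  rcases hr with hr | hr
  · obtain ⟨k, hk⟩ := (Projectivization.mk_eq_mk_iff' F4 _ _ _ _).mp hr
    refine huv (b⁻¹ * (k - a)) ?_
    rw [mul_smul, sub_smul, hk, add_sub_cancel_left, inv_smul_smul₀ hb]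
  · obtain ⟨k, hk⟩ := (Projectivization.mk_eq_mk_iff' F4 _ _ _ _).mp hr
    have e : a • u = (k - b) • v := by rw [sub_smul, hk, add_sub_cancel_right]
    rcases eq_or_ne (k - b) 0 with h0 | h0
    · rw [h0, zero_smul] at e
      exact (smul_ne_zero ha hu) e
    · exact huv ((k - b)⁻¹ * a) (by rw [mul_smul, e, inv_smul_smul₀ h0])

theorem LegalTrunc.exists_notMem {D : Set (PGPoint d)} (hD : LegalTrunc D)
    {u v : Fin (d + 1) → F4} (hu : u ≠ 0) (hv : v ≠ 0)
    (huD : Projectivization.mk F4 u hu ∉ D) (hvD : Projectivization.mk F4 v hv ∉ D)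
    (huv : ∀ k : F4, v ≠ k • u) :
    ∃ a b : F4, a ≠ 0 ∧ b ≠ 0 ∧ ∃ hw : a • u + b • v ≠ 0,
      Projectivization.mk F4 (a • u + b • v) hw ∉ D := by
  by_contra! h
  have hli : LinearIndependent F4 ![u, v] := by
    rw [LinearIndependent.pair_iff' hu]
    exact fun k hk => huv k hk.symm
  have hpq : Projectivization.mk F4 u hu ≠ Projectivization.mk F4 v hv := by
    intro e
    obtain ⟨k, hk⟩ := (Projectivization.mk_eq_mk_iff' F4 v u hv hu).mp e.symm
    exact huv k hk.symm
  refine hD (pointsIn (Submodule.span F4 {u, v})) ⟨_, ?_, rfl⟩ ?_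
  · have := finrank_span_eq_card hli
    rwa [Matrix.range_cons_cons_empty, Fintype.card_fin] at this
  refine (congrArg Set.ncard (Set.ext fun r => ?_)).trans (Set.ncard_pair hpq)
  induction r using Projectivization.ind with
  | _ w hw =>
  rw [Set.mem_sdiff, mk_mem_pointsIn, Submodule.mem_span_pair]
  constructor
  · rintro ⟨⟨a, b, rfl⟩, hwD⟩
    rcases eq_or_ne a 0 with ha | ha
    · exact Or.inr ((Projectivization.mk_eq_mk_iff' F4 _ _ _ _).mpr ⟨b, by simp [ha]⟩)
    rcases eq_or_ne b 0 with hb | hb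
    · exact Or.inl ((Projectivization.mk_eq_mk_iff' F4 _ _ _ _).mpr ⟨a, by simp [hb]⟩)
    exact absurd (h a b ha hb hw) hwD
  · rintro (e | e)
    · rw [e]
      obtain ⟨k, hk⟩ := (Projectivization.mk_eq_mk_iff' F4 _ _ _ _).mp e
      exact ⟨⟨k, 0, by simp [hk]⟩, huD⟩
    · rw [e]
      obtain ⟨k, hk⟩ := (Projectivization.mk_eq_mk_iff' F4 _ _ _ _).mp e
      exact ⟨⟨0, k, by simp [hk]⟩, hvD⟩

theorem ncard_pointsIn {W : Submodule F4 (Fin (d + 1) → F4)} {e : ℕ}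
    (hW : Module.finrank F4 W = e + 1) : (pointsIn W).ncard = bracket4 e := by
  have hr : pointsIn W =
      Set.range (Projectivization.map W.subtype W.injective_subtype : _ → PGPoint d) := by
    ext p
    induction p using Projectivization.ind with
    | _ v hv =>
    rw [mk_mem_pointsIn]
    constructor
    · intro h
      exact ⟨Projectivization.mk F4 ⟨v, h⟩ (by simpa using hv), by simp [Projectivization.map_mk]⟩
    · rintro ⟨q, hq⟩
      induction q using Projectivization.ind with
      | _ w hw =>
      rw [Projectivization.map_mk] at hq
      obtain ⟨k, hk⟩ := (Projectivization.mk_eq_mk_iff' F4 _ _ _ _).mp hq.symm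
      rw [← hk]
      exact W.smul_mem _ w.2
  rw [hr, ← Set.image_univ, Set.ncard_image_of_injective _
    (Projectivization.map_injective _ W.injective_subtype), Set.ncard_univ,
    Projectivization.card_of_finrank F4 W hW, F4.natCard, bracket4]

end Legality

section Cone

variable {ι C A : Type*} [AddCommGroup C] [Module F4 C] [AddCommGroup A] [Module F4 A]

/-- The vectors of `C × A` that lie over `0`, or are proportional to `(σ i, x)` with `x ∈ X i`. -/
def cone (σ : ι → C) (X : ι → Set A) : Set (C × A) :=
  {v | v.1 = 0 ∨ ∃ i, ∃ k : F4, k ≠ 0 ∧ k • v.1 = σ i ∧ k • v.2 ∈ X i}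

theorem smul_mem_cone {σ : ι → C} {X : ι → Set A} {s : F4} (hs : s ≠ 0) {v : C × A} :
    s • v ∈ cone σ X ↔ v ∈ cone σ X := by
  have key : ∀ {s : F4}, s ≠ 0 → ∀ {v : C × A}, v ∈ cone σ X → s • v ∈ cone σ X := by
    rintro s hs v (h | ⟨i, k, hk, h1, h2⟩)
    · exact Or.inl (by simp [h])
    · refine Or.inr ⟨i, k * s⁻¹, mul_ne_zero hk (inv_ne_zero hs), ?_, ?_⟩
      · rw [Prod.smul_fst, mul_smul, inv_smul_smul₀ hs, h1]
      · rwa [Prod.smul_snd, mul_smul, inv_smul_smul₀ hs]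
  refine ⟨fun h => ?_, key hs⟩
  simpa [smul_smul, hs] using key (inv_ne_zero hs) h

/-- The projective points represented by `σ` are pairwise distinct. -/
def DistinctDirections (σ : ι → C) : Prop :=
  (∀ i, σ i ≠ 0) ∧ ∀ i j, ∀ k : F4, k • σ i = σ j → i = j ∧ k = 1

/-- On the line joining two distinct points of the projective space of `C`, some third point is not
represented by `σ`. -/
def NoThreeCollinear (σ : ι → C) : Prop :=
  ∀ c c' : C, c ≠ 0 → c' ≠ 0 → (∀ k : F4, c' ≠ k • c) →
    ∃ a b : F4, a ≠ 0 ∧ b ≠ 0 ∧ ∀ i, ∀ k : F4, k • (a • c + b • c') ≠ σ i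

theorem exists_notMem_cone {σ : ι → C} {X : ι → Set A} (hσ : DistinctDirections σ)
    (hline : NoThreeCollinear σ) (hX : ∀ i, AffineLegal (X i)) {u v : C × A}
    (hu : u ∉ cone σ X) (hv : v ∉ cone σ X) (huv : ∀ k : F4, v ≠ k • u) :
    ∃ a b : F4, a ≠ 0 ∧ b ≠ 0 ∧ a • u + b • v ∉ cone σ X := by
  obtain ⟨c, x⟩ := u
  obtain ⟨c', x'⟩ := v
  simp only [cone, Set.mem_ofPred_eq, not_or, not_exists, not_and] at hu hv
  obtain ⟨hc, hu⟩ := hu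
  obtain ⟨hc', hv⟩ := hv
  by_cases hcc : ∃ k : F4, c' = k • c
  · obtain ⟨k, rfl⟩ := hcc
    have hk : k ≠ 0 := by rintro rfl; simp at hc'
    by_cases hs : ∃ i, ∃ s : F4, s ≠ 0 ∧ s • c = σ i
    · obtain ⟨i, s, hs, hsi⟩ := hs
      have hx := hu i s hs hsi
      have hx' := hv i (s * k⁻¹) (mul_ne_zero hs (inv_ne_zero hk))
        (by rw [mul_smul, inv_smul_smul₀ hk, hsi])
      obtain ⟨t, t0, t1, ht⟩ := (hX i).compl _ hx _ hx' (by
        intro e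
        rw [mul_smul] at e
        have e' := smul_right_injective A hs e
        apply huv k
        rw [Prod.smul_mk, e', smul_inv_smul₀ hk])
      refine ⟨1 - t, t * k⁻¹, sub_ne_zero.mpr (Ne.symm t1),
        mul_ne_zero t0 (inv_ne_zero hk), ?_⟩
      have e : (1 - t) • (c, x) + (t * k⁻¹) • (k • c, x') =
          (c, (1 - t) • x + (t * k⁻¹) • x') := by
        ext
        · simp [smul_smul, hk, ← add_smul]
        · simp
      rw [e]
      rintro (h | ⟨j, r, hr, h1, h2⟩)
      · exact hc h
      · simp only at h1 h2
        have h3 : (r * s⁻¹) • σ i = σ j := by rw [← hsi, mul_smul, inv_smul_smul₀ hs, h1]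
        obtain ⟨rfl, h4⟩ := hσ.2 _ _ _ h3
        obtain rfl : r = s := by field_simp at h4; exact h4
        apply ht
        convert h2 using 1
        module
    · obtain ⟨w, h0, h1, -, -⟩ := F4.exists_primitive
      refine ⟨1 - w, w * k⁻¹, sub_ne_zero.mpr (Ne.symm h1), mul_ne_zero h0 (inv_ne_zero hk), ?_⟩
      have e : (1 - w) • (c, x) + (w * k⁻¹) • (k • c, x') =
          (c, (1 - w) • x + (w * k⁻¹) • x') := by
        ext
        · simp [smul_smul, hk, ← add_smul]
        · simp
      rw [e]
      rintro (h | ⟨j, r, hr, h1, h2⟩)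
      · exact hc h
      · exact hs ⟨j, r, hr, h1⟩
  · push Not at hcc
    obtain ⟨a, b, ha, hb, hab⟩ := hline c c' hc hc' hcc
    refine ⟨a, b, ha, hb, ?_⟩
    rintro (h | ⟨i, k, hk, h1, h2⟩)
    · simp only [Prod.smul_mk, Prod.mk_add_mk] at h
      apply hcc (-(b⁻¹ * a))
      rw [neg_smul, mul_smul, eq_neg_of_add_eq_zero_left h, smul_neg, inv_smul_smul₀ hb, neg_neg]
    · exact hab i k h1

theorem exists_legalTrunc_of_cone {n e : ℕ} [Finite ι] [Finite A]
    {σ : ι → C} {X : ι → Set A}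
    (hσ : DistinctDirections σ) (hline : NoThreeCollinear σ) (hX : ∀ i, AffineLegal (X i))
    (hA : Module.finrank F4 A = e + 1)
    (φ : (C × A) ≃ₗ[F4] (Fin (n + 1) → F4)) :
    ∃ D : Set (PGPoint n), LegalTrunc D ∧
      D.ncard = {p : ι × A | p.2 ∈ X p.1}.ncard + bracket4 e ∧
      ∀ v (hv : v ≠ 0), Projectivization.mk F4 v hv ∈ D ↔ φ.symm v ∈ cone σ X := by
  have hmem : ∀ v (hv : v ≠ 0),
      Projectivization.mk F4 v hv ∈ {p : PGPoint n | φ.symm p.rep ∈ cone σ X} ↔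
        φ.symm v ∈ cone σ X := by
    intro v hv
    obtain ⟨s, hs⟩ := Projectivization.exists_smul_eq_mk_rep F4 v hv
    rw [Set.mem_ofPred_eq, ← hs, Units.smul_def, map_smul, smul_mem_cone s.ne_zero]
  refine ⟨{p | φ.symm p.rep ∈ cone σ X}, ?_, ?_, hmem⟩
  · apply legalTrunc_of_forall
    intro u v hu hv huD hvD huv
    rw [hmem] at huD hvD
    obtain ⟨a, b, ha, hb, hab⟩ := exists_notMem_cone hσ hline hX huD hvD (by
      intro k hk
      exact huv k (φ.symm.injective (by simpa using hk)))
    have h0 : a • u + b • v ≠ 0 := by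
      intro h
      apply hab
      rw [← map_smul, ← map_smul, ← map_add, h, map_zero]
      exact Or.inl rfl
    refine ⟨a, b, ha, hb, h0, ?_⟩
    rw [hmem]
    simpa using hab
  · set W := LinearMap.range (φ.toLinearMap ∘ₗ LinearMap.inr F4 C A) with hWdef
    have hW : Module.finrank F4 W = e + 1 := by
      rw [hWdef, LinearMap.finrank_range_of_inj, hA]
      exact φ.injective.comp LinearMap.inr_injective
    have hWmem : ∀ v, v ∈ W ↔ (φ.symm v).1 = 0 := by
      intro v
      constructor
      · rintro ⟨x, rfl⟩
        simp
      · intro h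
        exact ⟨(φ.symm v).2, by
          rw [LinearMap.comp_apply, LinearMap.inr_apply, ← h, Prod.mk.eta]; simp⟩
    have hg0 : ∀ p : ι × A, φ (σ p.1, p.2) ≠ 0 := by
      intro p h
      rw [LinearEquiv.map_eq_zero_iff] at h
      exact hσ.1 p.1 (congrArg Prod.fst h)
    let g : ι × A → PGPoint n := fun p => Projectivization.mk F4 (φ (σ p.1, p.2)) (hg0 p)
    have hg : Function.Injective g := by
      intro p q hpq
      obtain ⟨k, hk⟩ := (Projectivization.mk_eq_mk_iff' F4 _ _ _ _).mp hpq
      rw [← map_smul, φ.injective.eq_iff, Prod.smul_mk, Prod.mk.injEq] at hk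
      obtain ⟨h1, rfl⟩ := hσ.2 _ _ _ hk.1
      exact Prod.ext h1.symm (by simpa using hk.2.symm)
    have hD : {p : PGPoint n | φ.symm p.rep ∈ cone σ X} =
        g '' {p : ι × A | p.2 ∈ X p.1} ∪ pointsIn W := by
      ext r
      induction r using Projectivization.ind with
      | _ v hv =>
      rw [hmem, Set.mem_union, mk_mem_pointsIn, hWmem, or_comm]
      refine or_congr Iff.rfl ⟨?_, ?_⟩
      · rintro ⟨i, k, hk, h1, h2⟩
        refine ⟨(i, k • (φ.symm v).2), h2, ?_⟩
        refine (Projectivization.mk_eq_mk_iff' F4 _ _ _ _).mpr ⟨k, ?_⟩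
        apply φ.symm.injective
        rw [map_smul, LinearEquiv.symm_apply_apply, ← h1]
        rfl
      · rintro ⟨⟨i, x⟩, hx, h⟩
        obtain ⟨k, hk⟩ := (Projectivization.mk_eq_mk_iff' F4 _ _ _ _).mp h
        have hk' : k • φ.symm v = (σ i, x) := by
          rw [← map_smul, hk, LinearEquiv.symm_apply_apply]
        refine ⟨i, k, ?_, congrArg Prod.fst hk', ?_⟩
        · rintro rfl
          rw [zero_smul] at hk'
          exact hσ.1 i (congrArg Prod.fst hk').symm
        · rw [← Prod.smul_snd, hk']
          exact hx
    rw [hD, Set.ncard_union_eq ?_ (Set.toFinite _) (Set.toFinite _),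
      Set.ncard_image_of_injective _ hg, ncard_pointsIn hW]
    rw [Set.disjoint_left]
    rintro _ ⟨p, hp, rfl⟩ hpW
    rw [mk_mem_pointsIn, hWmem, LinearEquiv.symm_apply_apply] at hpW
    exact hσ.1 p.1 hpW

end Cone

section Sizes

theorem finrank_ker_of_ne_zero {n : ℕ} {V : Type*} [AddCommGroup V] [Module F4 V]
    [Module.Finite F4 V] (hV : Module.finrank F4 V = n + 1) {f : V →ₗ[F4] F4} (hf : f ≠ 0) :
    Module.finrank F4 (LinearMap.ker f) = n := by
  have h := f.finrank_range_add_finrank_ker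
  rw [LinearMap.range_eq_top.mpr (LinearMap.surjective hf), finrank_top, Module.finrank_self, hV] at h
  omega

theorem ncard_mem_SS {ι C A : Type*} [AddCommGroup C] [Module F4 C] [AddCommGroup A] [Module F4 A]
    [Finite ι] [Nonempty ι] [Module.Finite F4 C] [Module.Finite F4 A] {n e : ℕ}
    {σ : ι → C} {X : ι → Set A} (hσ : DistinctDirections σ) (hline : NoThreeCollinear σ)
    (hX : ∀ i, AffineLegal (X i)) (hA : Module.finrank F4 A = e + 1)
    (hC : Module.finrank F4 C + e = n) (f : C →ₗ[F4] F4) (hf : ∀ i, f (σ i) ≠ 0) :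
    {p : ι × A | p.2 ∈ X p.1}.ncard ∈ SS n e := by
  have : Finite A := Module.finite_of_finite F4
  have hCA : Module.finrank F4 (C × A) = Module.finrank F4 (Fin (n + 1) → F4) := by
    rw [Module.finrank_prod, Module.finrank_fin_fun, hA]
    omega
  let φ : (C × A) ≃ₗ[F4] (Fin (n + 1) → F4) := LinearEquiv.ofFinrankEq _ _ hCA
  obtain ⟨D, hD, hcard, hmem⟩ := exists_legalTrunc_of_cone hσ hline hX hA φ
  let F : (Fin (n + 1) → F4) →ₗ[F4] F4 := f ∘ₗ LinearMap.fst F4 C A ∘ₗ φ.symm.toLinearMap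
  have hF : F ≠ 0 := by
    intro h
    obtain ⟨i⟩ := ‹Nonempty ι›
    apply hf i
    simpa [F] using LinearMap.congr_fun h (φ (σ i, 0))
  refine ⟨D, hD, hcard, LinearMap.ker F, LinearMap.range (φ.toLinearMap ∘ₗ LinearMap.inr F4 C A),
    finrank_ker_of_ne_zero (Module.finrank_fin_fun F4) hF, ?_, ?_, ?_⟩
  · rw [LinearMap.finrank_range_of_inj, hA]
    exact φ.injective.comp LinearMap.inr_injective
  · rintro _ ⟨x, rfl⟩
    simp [F]
  · ext r
    induction r using Projectivization.ind with
    | _ v hv =>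
    rw [Set.mem_inter_iff, hmem, mk_mem_pointsIn, mk_mem_pointsIn, LinearMap.mem_ker]
    constructor
    · rintro ⟨h | ⟨i, k, hk, h1, h2⟩, hv⟩
      · exact ⟨(φ.symm v).2, by
          rw [LinearMap.comp_apply, LinearMap.inr_apply, ← h, Prod.mk.eta]; simp⟩
      · refine absurd ?_ (hf i)
        rw [← h1, map_smul, show f (φ.symm v).1 = 0 from hv, smul_zero]
    · rintro ⟨x, rfl⟩
      exact ⟨Or.inl (by simp), by simp [F]⟩

/-- The sizes of the subsets of `F4 ^ d` meeting no line in exactly two points. -/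
def affineSizes (d : ℕ) : Set ℕ := {n | ∃ X : Set (Fin d → F4), AffineLegal X ∧ X.ncard = n}

theorem affineSizes_subset_SS (e : ℕ) : affineSizes (e + 1) ⊆ SS (e + 1) e := by
  rintro n ⟨X, hX, rfl⟩
  have hσ : DistinctDirections (fun _ : Unit => (1 : F4)) :=
    ⟨fun _ => one_ne_zero, fun i j k hk => ⟨rfl, by simpa using hk⟩⟩
  have hline : NoThreeCollinear (fun _ : Unit => (1 : F4)) := by
    intro c c' hc _ h
    exact absurd (by simp [hc]) (h (c' / c))
  have h := ncard_mem_SS (n := e + 1) (X := fun _ => X) hσ hline (fun _ => hX)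
    (Module.finrank_fin_fun F4) (by rw [Module.finrank_self, add_comm]) LinearMap.id (by simp)
  convert h using 1
  rw [← Set.ncard_image_of_injective X (Prod.mk_right_injective ())]
  congr 1
  ext ⟨i, x⟩
  simp

theorem SS_subset_affineSizes (e : ℕ) : SS (e + 1) e ⊆ affineSizes (e + 1) := by
  rintro n ⟨D, hD, hcard, H, W, hH, hW, hWH, hDH⟩
  obtain rfl : W = H := Submodule.eq_of_le_of_finrank_eq hWH (hW.trans hH.symm)
  obtain ⟨w, hw⟩ : ∃ w, w ∉ W := by
    by_contra! h
    rw [(Submodule.eq_top_iff').mpr h, finrank_top, Module.finrank_fin_fun] at hW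
    omega
  obtain ⟨f, hfw, hfW⟩ := Submodule.exists_le_ker_of_notMem hw
  have hker : W = LinearMap.ker f := Submodule.eq_of_le_of_finrank_eq hfW (by
    rw [hW, finrank_ker_of_ne_zero (Module.finrank_fin_fun F4)]
    rintro rfl
    simp at hfw)
  have hmemW : ∀ v, v ∈ W ↔ f v = 0 := fun v => by rw [hker, LinearMap.mem_ker]
  let ψ : (Fin (e + 1) → F4) ≃ₗ[F4] W :=
    LinearEquiv.ofFinrankEq _ _ (by rw [hW, Module.finrank_fin_fun])
  have hψ : ∀ x, f (ψ x) = 0 := fun x => hfW (ψ x).2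
  have hne : ∀ x, w + ψ x ≠ 0 := by
    intro x h
    have := congrArg f h
    rw [map_add, hψ, add_zero, map_zero] at this
    exact hfw this
  let g : (Fin (e + 1) → F4) → PGPoint (e + 1) := fun x => Projectivization.mk F4 (w + ψ x) (hne x)
  have hg : Function.Injective g := by
    intro x y hxy
    obtain ⟨k, hk⟩ := (Projectivization.mk_eq_mk_iff' F4 _ _ _ _).mp hxy
    have h1 := congrArg f hk
    rw [map_smul, map_add, map_add, hψ, hψ, add_zero, smul_eq_mul] at h1
    obtain rfl : k = 1 := mul_right_cancel₀ hfw (h1.trans (one_mul _).symm)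
    rw [one_smul, add_right_inj] at hk
    exact ψ.injective (Subtype.ext hk.symm)
  have hDW : pointsIn W ⊆ D := fun p hp => (hDH.symm ▸ hp : p ∈ D ∩ pointsIn W).1
  refine ⟨g ⁻¹' D, ?_, ?_⟩
  · rw [← compl_compl (g ⁻¹' D)]
    apply AffineLegal.compl
    intro x hx y hy hxy
    obtain ⟨a, b, ha, hb, h0, hab⟩ := hD.exists_notMem (hne x) (hne y) hx hy (by
      intro k hk
      exact hxy (hg ((Projectivization.mk_eq_mk_iff' F4 _ _ _ _).mpr ⟨k, hk.symm⟩)).symm)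
    have hs : a + b ≠ 0 := by
      intro hs
      apply hab (hDW _)
      rw [mk_mem_pointsIn, hmemW, map_add, map_smul, map_smul, map_add, map_add,
        hψ, hψ, ← add_smul, hs, zero_smul]
    refine ⟨b / (a + b), div_ne_zero hb hs, ?_, ?_⟩
    · rw [Ne, div_eq_one_iff_eq hs]
      simpa using ha
    · rw [Set.mem_compl_iff, Set.mem_preimage]
      convert hab using 2
      refine (Projectivization.mk_eq_mk_iff' F4 _ _ _ _).mpr ⟨(a + b)⁻¹, ?_⟩
      rw [inv_smul_eq_iff₀ hs]
      simp only [map_add, map_smul, map_sub, Submodule.coe_add, Submodule.coe_smul,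
        Submodule.coe_sub]
      have : (a + b) * (b / (a + b)) = b := mul_div_cancel₀ _ hs
      rw [smul_add (a + b), smul_add (a + b), smul_smul, this]
      module
  · have hDu : D = g '' (g ⁻¹' D) ∪ pointsIn W := by
      ext r
      refine ⟨fun hr => ?_, ?_⟩
      · by_cases hrW : r ∈ pointsIn W
        · exact Or.inr hrW
        left
        induction r using Projectivization.ind with
        | _ v hv =>
        rw [mk_mem_pointsIn, hmemW] at hrW
        have hm : (f w / f v) • v - w ∈ W := by
          rw [hmemW, map_sub, map_smul, smul_eq_mul, div_mul_cancel₀ _ hrW,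
            sub_self]
        have he : g (ψ.symm ⟨_, hm⟩) = Projectivization.mk F4 v hv :=
          (Projectivization.mk_eq_mk_iff' F4 _ _ _ _).mpr ⟨f w / f v, by simp⟩
        exact ⟨_, by rw [Set.mem_preimage, he]; exact hr, he⟩
      · rintro (⟨x, hx, rfl⟩ | hr)
        · exact hx
        · exact hDW hr
    have hdis : Disjoint (g '' (g ⁻¹' D)) (pointsIn W) := by
      rw [Set.disjoint_left]
      rintro _ ⟨x, -, rfl⟩ hx
      rw [mk_mem_pointsIn, hmemW, map_add, hψ, add_zero] at hx
      exact hfw hx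
    rw [hDu, Set.ncard_union_eq hdis (Set.toFinite _) (Set.toFinite _), ncard_pointsIn hW,
      Set.ncard_image_of_injective _ hg] at hcard
    simpa using hcard

theorem zero_mem_affineSizes (d : ℕ) : 0 ∈ affineSizes d :=
  ⟨∅, fun _ h => h.elim, Set.ncard_empty _⟩

theorem affineSizes_compl {d n m : ℕ} (hn : n ∈ affineSizes d) (h : n + m = 4 ^ d) :
    m ∈ affineSizes d := by
  obtain ⟨X, hX, rfl⟩ := hn
  refine ⟨Xᶜ, hX.compl, ?_⟩
  have hc := Set.ncard_add_ncard_compl X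
  rw [Nat.card_fun, F4.natCard, Nat.card_fin] at hc
  omega

theorem le_of_mem_affineSizes {d n : ℕ} (hn : n ∈ affineSizes d) : n ≤ 4 ^ d := by
  obtain ⟨X, -, rfl⟩ := hn
  have hc := Set.ncard_le_card X
  rwa [Nat.card_fun, F4.natCard, Nat.card_fin] at hc

theorem affineSizes_subset_succ (d : ℕ) : affineSizes d ⊆ affineSizes (d + 1) := by
  rintro n ⟨X, hX, rfl⟩
  refine ⟨Fin.cons 0 '' X, ?_, Set.ncard_image_of_injective X (Fin.cons_right_injective 0)⟩
  rintro _ ⟨x, hx, rfl⟩ _ ⟨y, hy, rfl⟩ hxy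
  obtain ⟨t, t0, t1, ht⟩ := hX x hx y hy (fun h => hxy (by rw [h]))
  refine ⟨t, t0, t1, _, ht, ?_⟩
  ext i
  refine Fin.cases ?_ (fun j => ?_) i <;> simp

theorem add_mem_affineSizes_succ {d n : ℕ} (hn : n ∈ affineSizes d) :
    n + 3 * 4 ^ d ∈ affineSizes (d + 1) := by
  have hle := le_of_mem_affineSizes hn
  have h1 : 4 ^ d - n ∈ affineSizes d := affineSizes_compl hn (by omega)
  exact affineSizes_compl (affineSizes_subset_succ d h1) (by rw [pow_succ]; omega)

theorem exists_four_affineSizes (d : ℕ) : ∀ n ≤ 4 ^ (d + 1),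
    ∃ a ∈ affineSizes d, ∃ b ∈ affineSizes d, ∃ c ∈ affineSizes d, ∃ e ∈ affineSizes d,
      a + b + c + e = n := by
  induction d with
  | zero =>
    intro n hn
    have h0 := zero_mem_affineSizes 0
    have h1 : 1 ∈ affineSizes 0 := affineSizes_compl h0 (by norm_num)
    obtain rfl | rfl | rfl | rfl | rfl : n = 0 ∨ n = 1 ∨ n = 2 ∨ n = 3 ∨ n = 4 := by omega
    · exact ⟨0, h0, 0, h0, 0, h0, 0, h0, rfl⟩
    · exact ⟨1, h1, 0, h0, 0, h0, 0, h0, rfl⟩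
    · exact ⟨1, h1, 1, h1, 0, h0, 0, h0, rfl⟩
    · exact ⟨1, h1, 1, h1, 1, h1, 0, h0, rfl⟩
    · exact ⟨1, h1, 1, h1, 1, h1, 1, h1, rfl⟩
  | succ d ih =>
    intro n hn
    have lift := affineSizes_subset_succ d
    have shift : ∀ {m}, m ∈ affineSizes d → m + 3 * 4 ^ d ∈ affineSizes (d + 1) :=
      add_mem_affineSizes_succ
    obtain ⟨k, hk4, hk, hk'⟩ :
        ∃ k ≤ 4, k * (3 * 4 ^ d) ≤ n ∧ n - k * (3 * 4 ^ d) ≤ 4 ^ (d + 1) := by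
      refine ⟨min 4 (n / (3 * 4 ^ d)), min_le_left _ _, ?_, ?_⟩
      · exact (Nat.mul_le_mul_right _ (min_le_right _ _)).trans (Nat.div_mul_le_self _ _)
      · rcases le_total 4 (n / (3 * 4 ^ d)) with h | h
        · rw [min_eq_left h]
          rw [pow_succ, pow_succ] at hn
          rw [pow_succ]
          omega
        · rw [min_eq_right h, mul_comm, ← Nat.mod_eq_sub_mul_div]
          have := Nat.mod_lt n (show 0 < 3 * 4 ^ d by positivity)
          rw [pow_succ]
          omega
    obtain ⟨a, ha, b, hb, c, hc, e, he, hsum⟩ := ih _ hk'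
    interval_cases k
    · exact ⟨a, lift ha, b, lift hb, c, lift hc, e, lift he, by omega⟩
    · exact ⟨_, shift ha, b, lift hb, c, lift hc, e, lift he, by omega⟩
    · exact ⟨_, shift ha, _, shift hb, c, lift hc, e, lift he, by omega⟩
    · exact ⟨_, shift ha, _, shift hb, _, shift hc, e, lift he, by omega⟩
    · exact ⟨_, shift ha, _, shift hb, _, shift hc, _, shift he, by omega⟩

end Sizes

section Conic

/-- Four points of a conic in the projective plane. -/
noncomputable def conic (s : F4) : F4 × F4 × F4 := (1, s, s * s)

theorem distinctDirections_conic {ι : Type*} (ε : ι ≃ F4) :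
    DistinctDirections (conic ∘ ε) := by
  refine ⟨fun i h => one_ne_zero (congrArg Prod.fst h), fun i j k hk => ?_⟩
  simp only [conic, Function.comp_apply, Prod.smul_mk, smul_eq_mul, mul_one, Prod.mk.injEq] at hk
  obtain ⟨rfl, hk, -⟩ := hk
  exact ⟨ε.injective (by simpa using hk), rfl⟩

theorem noThreeCollinear_conic {ι : Type*} (ε : ι ≃ F4) :
    NoThreeCollinear (conic ∘ ε) := by
  rintro ⟨x, y, z⟩ ⟨x', y', z'⟩ hc hc' -
  by_contra! h
  obtain ⟨w, h0, h1, hw, hall⟩ := F4.exists_primitive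
  have h2 : (2 : F4) = 0 := CharTwo.two_eq_zero
  have e1 : w + 1 ≠ 0 := fun h => h1 (CharTwo.add_eq_zero.mp h)
  have key : ∀ b : F4, b ≠ 0 → x + b * x' ≠ 0 ∧
      (x * z - y * y) + b * (x * z' + x' * z) + b * b * (x' * z' - y' * y') = 0 := by
    intro b hb
    obtain ⟨i, k, hk⟩ := h 1 b one_ne_zero hb
    simp only [conic, Function.comp_apply, Prod.smul_mk, smul_eq_mul, Prod.mk_add_mk, one_mul,
      Prod.mk.injEq] at hk
    obtain ⟨k1, k2, k3⟩ := hk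
    have hk0 : k ≠ 0 := by
      rintro rfl
      simp at k1
    have hx0 : x + b * x' ≠ 0 := by
      intro h
      rw [h, mul_zero] at k1
      exact zero_ne_one k1
    refine ⟨hx0, ?_⟩
    have hq : k * k * ((x + b * x') * (z + b * z') - (y + b * y') * (y + b * y')) = 0 := by
      linear_combination k * (z + b * z') * k1 + k3 - (k * (y + b * y') + ε i) * k2
    have hq' := (mul_eq_zero.mp hq).resolve_left (mul_ne_zero hk0 hk0)
    linear_combination hq' + b * y * y' * h2
  obtain ⟨n1, q1⟩ := key 1 one_ne_zero
  obtain ⟨n2, q2⟩ := key w h0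
  obtain ⟨n3, q3⟩ := key (w + 1) e1
  have hA : x * z - y * y = 0 := by
    generalize x * z - y * y = A at *
    generalize x * z' + x' * z = B at *
    generalize x' * z' - y' * y' = C at *
    linear_combination q1 + q2 + q3 - (A + (w + 1) * B + (1 + w * w + w) * C) * h2
  have hB : x * z' + x' * z = 0 := by
    linear_combination w * w * q1 - q2 - (x * z' + x' * z) * hw - (w * w - 1) * hA
  have hC : x' * z' - y' * y' = 0 := by
    linear_combination q1 - hA - hB
  rcases eq_or_ne x' 0 with rfl | hx'
  · have hx : x ≠ 0 := by simpa using n1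
    have hy' : y' = 0 := by simpa using hC
    have hz' : z' = 0 := by simpa [hx] using hB
    exact hc' (by simp [hy', hz'])
  · have hx : x = 0 := by
      by_contra hx
      apply (key (x / x') (div_ne_zero hx hx')).1
      rw [div_mul_cancel₀ _ hx', F4.add_self]
    subst hx
    have hy : y = 0 := by simpa using hA
    have hz : z = 0 := by simpa [hx'] using hB
    exact hc (by simp [hy, hz])

theorem ncard_prod_eq_sum {ι A : Type*} [Fintype ι] [Finite A] (X : ι → Set A) :
    {p : ι × A | p.2 ∈ X p.1}.ncard = ∑ i, (X i).ncard := by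
  let E : {p : ι × A | p.2 ∈ X p.1} ≃ Σ i, X i :=
    { toFun := fun p => ⟨p.1.1, p.1.2, p.2⟩
      invFun := fun q => ⟨(q.1, q.2.1), q.2.2⟩
      left_inv := fun _ => rfl
      right_inv := fun _ => rfl }
  rw [← Nat.card_coe_set_eq, Nat.card_congr E, Nat.card_sigma]
  rfl

theorem add_four_mem_SS {e a b c f : ℕ} (ha : a ∈ affineSizes (e + 1))
    (hb : b ∈ affineSizes (e + 1)) (hc : c ∈ affineSizes (e + 1)) (hf : f ∈ affineSizes (e + 1)) :
    a + b + c + f ∈ SS (e + 1 + 2) e := by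
  obtain ⟨X₁, h₁, rfl⟩ := ha
  obtain ⟨X₂, h₂, rfl⟩ := hb
  obtain ⟨X₃, h₃, rfl⟩ := hc
  obtain ⟨X₄, h₄, rfl⟩ := hf
  let ε : Fin 4 ≃ F4 := (Finite.equivFinOfCardEq F4.natCard).symm
  have h := ncard_mem_SS (n := e + 1 + 2) (X := ![X₁, X₂, X₃, X₄]) (distinctDirections_conic ε)
    (noThreeCollinear_conic ε) (by intro i; fin_cases i <;> assumption)
    (Module.finrank_fin_fun F4)
    (by simp only [Module.finrank_prod, Module.finrank_self]; omega)
    (LinearMap.fst F4 F4 (F4 × F4)) (by simp [conic])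
  rw [ncard_prod_eq_sum, Fin.sum_univ_four] at h
  exact h

end Conic

open Pointwise in
/-- For every `d ≥ 1`, the interval `[0, 4^{d+1}]` is contained in the four-fold sumset
`S(d,d-1) + S(d,d-1) + S(d,d-1) + S(d,d-1)`, which in turn is contained in `S(d+2,d-1)`. -/
theorem statement13 (d : ℕ) (hd : 1 ≤ d) :
    (∀ n : ℕ, n ≤ 4 ^ (d + 1) →
      n ∈ SS d (d - 1) + SS d (d - 1) + SS d (d - 1) + SS d (d - 1)) ∧
    SS d (d - 1) + SS d (d - 1) + SS d (d - 1) + SS d (d - 1) ⊆ SS (d + 2) (d - 1) := by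
  obtain ⟨e, rfl⟩ := Nat.exists_eq_add_of_le' hd
  rw [Nat.add_sub_cancel]
  refine ⟨fun n hn => ?_, ?_⟩
  · obtain ⟨a, ha, b, hb, c, hc, f, hf, rfl⟩ := exists_four_affineSizes (e + 1) n hn
    have h := affineSizes_subset_SS e
    exact Set.add_mem_add (Set.add_mem_add (Set.add_mem_add (h ha) (h hb)) (h hc)) (h hf)
  · rintro _ ⟨_, ⟨_, ⟨a, ha, b, hb, rfl⟩, c, hc, rfl⟩, f, hf, rfl⟩
    have h := SS_subset_affineSizes e
    exact add_four_mem_SS (h ha) (h hb) (h hc) (h hf)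
end

section
/- (Inflation case.) For every integer d ≥ 3 and every integer v with [d]₄ ≤ v ≤ 3[d]₄: if v - [d]₄ ∉ {1,3,9} then there exists a PBD(v,{3,4,5}) in which every set of three points is contained in a flat of size at most 63; and if v - [d]₄ ∈ {1,3,9} then there exists a PBD(v,{3,4,5}) in which every set of three points is contained in a flat of size at most 94. -/
/-- `IsPBD V K Blocks` : the blocks form a pairwise balanced design on point set `V`
with block sizes in `K`: every block is a subset of `V` of size in `K`, and every
pair of distinct points of `V` lies in exactly one block. -/
def IsPBD {X : Type*} (V : Finset X) (K : Set ℕ) (Blocks : Finset (Finset X)) : Prop :=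
  (∀ B ∈ Blocks, B ⊆ V ∧ B.card ∈ K) ∧
    ∀ x ∈ V, ∀ y ∈ V, x ≠ y → ∃! B, B ∈ Blocks ∧ x ∈ B ∧ y ∈ B

/-- `IsFlat V Blocks Y` : `Y` is a flat of the design `(V, Blocks)`: `Y ⊆ V` and every
pair of distinct points of `Y` lies in a block entirely contained in `Y`. -/
def IsFlat {X : Type*} (V : Finset X) (Blocks : Finset (Finset X)) (Y : Finset X) : Prop :=
  Y ⊆ V ∧ ∀ x ∈ Y, ∀ y ∈ Y, x ≠ y → ∃ B ∈ Blocks, x ∈ B ∧ y ∈ B ∧ B ⊆ Y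

open Finset Module
open scoped LinearAlgebra.Projectivization

/-- The group of the point `x` when the points `0, …, 3c - 1` are split into consecutive triples
and all other points form groups of size one. -/
def designGroup (c x : ℕ) : ℕ := if x < 3 * c then x / 3 else x

/-- `HasDesign b c`: there is a group divisible design with `c` groups of size three, `b` groups of
size one and block sizes in `{3,4,5}`. Its points are `0, …, 3c + b - 1`. -/
def HasDesign (b c : ℕ) : Prop :=
  ∃ l : List (List ℕ),
    (∀ B ∈ l, B.Nodup ∧ (B.length = 3 ∨ B.length = 4 ∨ B.length = 5) ∧
      (∀ x ∈ B, x < 3 * c + b) ∧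
      ∀ x ∈ B, ∀ y ∈ B, designGroup c x = designGroup c y → x = y) ∧
    ∀ x < 3 * c + b, ∀ y < 3 * c + b, designGroup c x ≠ designGroup c y →
      (l.filter fun B => x ∈ B ∧ y ∈ B).length = 1

theorem hasDesign_0_0 : HasDesign 0 0 := ⟨[], by decide⟩

theorem hasDesign_5_0 : HasDesign 5 0 :=
  ⟨[
    [0, 1, 2, 3, 4]], by decide +kernel⟩

theorem hasDesign_4_0 : HasDesign 4 0 :=
  ⟨[
    [0, 1, 2, 3]], by decide +kernel⟩

theorem hasDesign_3_0 : HasDesign 3 0 :=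
  ⟨[
    [0, 1, 2]], by decide +kernel⟩

theorem hasDesign_4_1 : HasDesign 4 1 :=
  ⟨[
    [0, 3, 4], [0, 5, 6], [1, 3, 6], [1, 4, 5], [2, 3, 5], [2, 4, 6]], by decide +kernel⟩

theorem hasDesign_3_2 : HasDesign 3 2 :=
  ⟨[
    [0, 3, 6], [0, 4, 7], [0, 5, 8], [1, 3, 7], [1, 4, 8], [1, 5, 6], [2, 3, 8], [2, 4, 6],
    [2, 5, 7], [6, 7, 8]], by decide +kernel⟩

theorem hasDesign_2_3 : HasDesign 2 3 :=
  ⟨[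
    [0, 3, 7, 9, 10], [0, 4, 6], [0, 5, 8], [1, 3, 8], [1, 4, 10], [1, 5, 7], [1, 6, 9],
    [2, 3, 6], [2, 4, 7], [2, 5, 9], [2, 8, 10], [4, 8, 9], [5, 6, 10]], by decide +kernel⟩

theorem hasDesign_1_4 : HasDesign 1 4 :=
  ⟨[
    [0, 3, 7, 9, 12], [0, 4, 8], [0, 5, 10], [0, 6, 11], [1, 3, 11], [1, 4, 6, 10, 12],
    [1, 5, 7], [1, 8, 9], [2, 3, 6], [2, 4, 9], [2, 5, 8, 11, 12], [2, 7, 10], [3, 8, 10],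
    [4, 7, 11], [5, 6, 9]], by decide +kernel⟩

theorem hasDesign_0_5 : HasDesign 0 5 :=
  ⟨[
    [0, 3, 11, 14], [0, 4, 8, 10], [0, 5, 6, 9, 12], [0, 7, 13], [1, 3, 6], [1, 4, 7, 9, 14],
    [1, 5, 10, 13], [1, 8, 11, 12], [2, 3, 8, 9, 13], [2, 4, 12], [2, 5, 7, 11], [2, 6, 10, 14],
    [3, 7, 10, 12], [4, 6, 11, 13], [5, 8, 14]], by decide +kernel⟩

theorem hasDesign_1_3 : HasDesign 1 3 :=
  ⟨[
    [0, 3, 7], [0, 4, 6, 9], [0, 5, 8], [1, 3, 6], [1, 4, 8], [1, 5, 7, 9], [2, 3, 8, 9],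
    [2, 4, 7], [2, 5, 6]], by decide +kernel⟩

theorem hasDesign_0_4 : HasDesign 0 4 :=
  ⟨[
    [0, 3, 6, 10], [0, 4, 7, 9], [0, 5, 8, 11], [1, 3, 8, 9], [1, 4, 6, 11], [1, 5, 7, 10],
    [2, 3, 7, 11], [2, 4, 8, 10], [2, 5, 6, 9]], by decide +kernel⟩

theorem hasDesign_14_0 : HasDesign 14 0 :=
  ⟨[
    [0, 1, 2, 3], [0, 4, 8, 12, 13], [0, 5, 9], [0, 6, 10], [0, 7, 11], [1, 4, 9], [1, 5, 8],
    [1, 6, 11, 13], [1, 7, 10, 12], [2, 4, 10], [2, 5, 11, 12], [2, 6, 8], [2, 7, 9, 13],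
    [3, 4, 11], [3, 5, 10, 13], [3, 6, 9, 12], [3, 7, 8], [4, 5, 6, 7], [8, 9, 10, 11]],
    by decide +kernel⟩

theorem hasDesign_19_1 : HasDesign 19 1 :=
  ⟨[
    [0, 3, 6], [0, 4, 19], [0, 5, 10], [0, 7, 17], [0, 8, 14, 21], [0, 9, 20], [0, 11, 15],
    [0, 12, 13], [0, 16, 18], [1, 3, 10], [1, 4, 7], [1, 5, 20], [1, 6, 11], [1, 8, 18],
    [1, 9, 15, 21], [1, 12, 16], [1, 13, 14], [1, 17, 19], [2, 3, 16, 21], [2, 4, 20], [2, 5, 7],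
    [2, 6, 15], [2, 8, 12], [2, 9, 17], [2, 10, 18], [2, 11, 14], [2, 13, 19], [3, 4, 11],
    [3, 5, 8], [3, 7, 12], [3, 9, 19], [3, 13, 17], [3, 14, 15], [3, 18, 20], [4, 5, 12],
    [4, 6, 9], [4, 8, 13], [4, 10, 17, 21], [4, 14, 18], [4, 15, 16], [5, 6, 13], [5, 9, 14],
    [5, 11, 18, 21], [5, 15, 19], [5, 16, 17], [6, 7, 14], [6, 8, 10], [6, 12, 19, 21],
    [6, 16, 20], [6, 17, 18], [7, 8, 15], [7, 9, 11], [7, 10, 16], [7, 13, 20, 21], [7, 18, 19],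
    [8, 9, 16], [8, 11, 17], [8, 19, 20], [9, 10, 13], [9, 12, 18], [10, 11, 19], [10, 12, 15],
    [10, 14, 20], [11, 12, 20], [11, 13, 16], [12, 14, 17], [13, 15, 18], [14, 16, 19],
    [15, 17, 20]], by decide +kernel⟩

theorem hasDesign_18_2 : HasDesign 18 2 :=
  ⟨[
    [0, 3, 10], [0, 4, 22], [0, 5, 12, 18], [0, 6, 11], [0, 7, 20], [0, 8, 16], [0, 9, 23],
    [0, 13, 17], [0, 14, 15], [0, 19, 21], [1, 3, 11], [1, 4, 12], [1, 5, 13], [1, 6, 7],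
    [1, 8, 14, 20], [1, 9, 22], [1, 10, 18], [1, 15, 19], [1, 16, 17], [1, 21, 23], [2, 3, 12],
    [2, 4, 8], [2, 5, 15], [2, 6, 14], [2, 7, 10], [2, 9, 16], [2, 11, 17, 23], [2, 13, 21],
    [2, 18, 22], [2, 19, 20], [3, 6, 23], [3, 7, 13, 19], [3, 8, 21], [3, 9, 17], [3, 14, 18],
    [3, 15, 16], [3, 20, 22], [4, 6, 13], [4, 7, 14], [4, 9, 15, 21], [4, 10, 23], [4, 11, 19],
    [4, 16, 20], [4, 17, 18], [5, 6, 9], [5, 7, 16], [5, 8, 11], [5, 10, 17], [5, 14, 22],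
    [5, 19, 23], [5, 20, 21], [6, 8, 15], [6, 10, 16, 22], [6, 12, 20], [6, 17, 21], [6, 18, 19],
    [7, 8, 17], [7, 9, 12], [7, 11, 18], [7, 15, 23], [7, 21, 22], [8, 9, 18], [8, 10, 13],
    [8, 12, 19], [8, 22, 23], [9, 10, 19], [9, 11, 14], [9, 13, 20], [10, 11, 20], [10, 12, 15],
    [10, 14, 21], [11, 12, 21], [11, 13, 16], [11, 15, 22], [12, 13, 22], [12, 14, 17],
    [12, 16, 23], [13, 14, 23], [13, 15, 18], [14, 16, 19], [15, 17, 20], [16, 18, 21],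
    [17, 19, 22], [18, 20, 23]], by decide +kernel⟩

theorem hasDesign_15_5 : HasDesign 15 5 :=
  ⟨[
    [0, 3, 6], [0, 4, 8], [0, 5, 7], [0, 9, 18], [0, 10, 20], [0, 11, 19], [0, 12, 24],
    [0, 13, 26], [0, 14, 25], [0, 15, 21, 29], [0, 16, 23, 28], [0, 17, 22, 27], [1, 3, 8],
    [1, 4, 7], [1, 5, 6], [1, 9, 20], [1, 10, 19], [1, 11, 18], [1, 12, 26], [1, 13, 25],
    [1, 14, 24], [1, 15, 23, 27], [1, 16, 22, 29], [1, 17, 21, 28], [2, 3, 7], [2, 4, 6],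
    [2, 5, 8], [2, 9, 19], [2, 10, 18], [2, 11, 20], [2, 12, 25], [2, 13, 24], [2, 14, 26],
    [2, 15, 22, 28], [2, 16, 21, 27], [2, 17, 23, 29], [3, 9, 24, 29], [3, 10, 26, 28],
    [3, 11, 25, 27], [3, 12, 21], [3, 13, 23], [3, 14, 22], [3, 15, 18], [3, 16, 20],
    [3, 17, 19], [4, 9, 26, 27], [4, 10, 25, 29], [4, 11, 24, 28], [4, 12, 23], [4, 13, 22],
    [4, 14, 21], [4, 15, 20], [4, 16, 19], [4, 17, 18], [5, 9, 25, 28], [5, 10, 24, 27],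
    [5, 11, 26, 29], [5, 12, 22], [5, 13, 21], [5, 14, 23], [5, 15, 19], [5, 16, 18],
    [5, 17, 20], [6, 9, 21], [6, 10, 23], [6, 11, 22], [6, 12, 18, 29], [6, 13, 20, 28],
    [6, 14, 19, 27], [6, 15, 24], [6, 16, 26], [6, 17, 25], [7, 9, 23], [7, 10, 22], [7, 11, 21],
    [7, 12, 20, 27], [7, 13, 19, 29], [7, 14, 18, 28], [7, 15, 26], [7, 16, 25], [7, 17, 24],
    [8, 9, 22], [8, 10, 21], [8, 11, 23], [8, 12, 19, 28], [8, 13, 18, 27], [8, 14, 20, 29],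
    [8, 15, 25], [8, 16, 24], [8, 17, 26], [9, 12, 15], [9, 13, 17], [9, 14, 16], [10, 12, 17],
    [10, 13, 16], [10, 14, 15], [11, 12, 16], [11, 13, 15], [11, 14, 17], [15, 16, 17],
    [18, 19, 20], [18, 21, 24], [18, 22, 26], [18, 23, 25], [19, 21, 26], [19, 22, 25],
    [19, 23, 24], [20, 21, 25], [20, 22, 24], [20, 23, 26], [21, 22, 23], [24, 25, 26],
    [27, 28, 29]], by decide +kernel⟩

theorem exists_bijOn_range {Q : Type*} (A : Finset Q) (q₀ : Q) :
    ∃ e : ℕ → Q, Set.BijOn e (range A.card : Finset ℕ) A := by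
  have : Nonempty Q := ⟨q₀⟩
  refine Set.Finite.exists_bijOn_of_encard_eq (Finset.finite_toSet _) ?_
  rw [Set.encard_coe_eq_coe_finsetCard, Set.encard_coe_eq_coe_finsetCard, card_range]

section Inflation

variable {Q : Type*} [DecidableEq Q]

/-- The points lying above `T` when every point `q` is replaced by `w q` copies of itself. -/
def inflate (w : Q → ℕ) (T : Finset Q) : Finset (Q × ℕ) :=
  T.biUnion fun q => {q} ×ˢ range (w q)

theorem mem_inflate {w : Q → ℕ} {T : Finset Q} {x : Q × ℕ} :
    x ∈ inflate w T ↔ x.1 ∈ T ∧ x.2 < w x.1 := by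
  rcases x with ⟨q, j⟩
  simp only [inflate, mem_biUnion, mem_product, mem_singleton, mem_range]
  constructor
  · rintro ⟨r, hr, rfl, h⟩
    exact ⟨hr, h⟩
  · rintro ⟨h1, h2⟩
    exact ⟨q, h1, rfl, h2⟩

theorem card_inflate (w : Q → ℕ) (T : Finset Q) : (inflate w T).card = ∑ q ∈ T, w q := by
  rw [inflate, card_biUnion]
  · simp
  · intro p _ q _ hpq
    change Disjoint ({p} ×ˢ range (w p)) ({q} ×ˢ range (w q))
    rw [Finset.disjoint_left]
    rintro ⟨r, j⟩ h1 h2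
    simp only [mem_product, mem_singleton] at h1 h2
    exact hpq (h1.1.symm.trans h2.1)

/-- The points above `L` carry a group divisible design whose groups are the fibres. -/
def HasGDD (w : Q → ℕ) (L : Finset Q) : Prop :=
  ∃ 𝓑 : Finset (Finset (Q × ℕ)),
    (∀ B ∈ 𝓑, B ⊆ inflate w L ∧ B.card ∈ ({3, 4, 5} : Set ℕ) ∧
      ∀ x ∈ B, ∀ y ∈ B, x.1 = y.1 → x = y) ∧
    ∀ x ∈ inflate w L, ∀ y ∈ inflate w L, x.1 ≠ y.1 → ∃! B, B ∈ 𝓑 ∧ x ∈ B ∧ y ∈ B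

/-- Enumerate the points above `L` so that fibres of size three come first. -/
theorem exists_enumeration {w : Q → ℕ} {L : Finset Q}
    (hw : ∀ q ∈ L, w q = 0 ∨ w q = 1 ∨ w q = 3) {b c : ℕ}
    (hb : (L.filter fun q => w q = 1).card = b) (hc : (L.filter fun q => w q = 3).card = c)
    (q₀ : Q) :
    ∃ f : ℕ → Q × ℕ, Set.BijOn f (range (3 * c + b) : Finset ℕ) (inflate w L) ∧
      ∀ x < 3 * c + b, ∀ y < 3 * c + b,
        ((f x).1 = (f y).1 ↔ designGroup c x = designGroup c y) := by
  obtain ⟨e1, h1⟩ := exists_bijOn_range (L.filter fun q => w q = 1) q₀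
  obtain ⟨e3, h3⟩ := exists_bijOn_range (L.filter fun q => w q = 3) q₀
  rw [hb] at h1
  rw [hc] at h3
  have m1 : ∀ i < b, e1 i ∈ L ∧ w (e1 i) = 1 := fun i hi => by
    simpa using h1.mapsTo (by simpa using hi)
  have m3 : ∀ i < c, e3 i ∈ L ∧ w (e3 i) = 3 := fun i hi => by
    simpa using h3.mapsTo (by simpa using hi)
  have i1 : ∀ i < b, ∀ j < b, e1 i = e1 j → i = j := fun i hi j hj h =>
    h1.injOn (by simpa using hi) (by simpa using hj) h
  have i3 : ∀ i < c, ∀ j < c, e3 i = e3 j → i = j := fun i hi j hj h =>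
    h3.injOn (by simpa using hi) (by simpa using hj) h
  have s1 : ∀ q ∈ L, w q = 1 → ∃ i < b, e1 i = q := fun q hq h => by
    simpa using h1.surjOn (by simpa using ⟨hq, h⟩)
  have s3 : ∀ q ∈ L, w q = 3 → ∃ i < c, e3 i = q := fun q hq h => by
    simpa using h3.surjOn (by simpa using ⟨hq, h⟩)
  let f : ℕ → Q × ℕ := fun n => if n < 3 * c then (e3 (n / 3), n % 3) else (e1 (n - 3 * c), 0)
  have hf3 : ∀ n, n < 3 * c → f n = (e3 (n / 3), n % 3) := fun n hn => if_pos hn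
  have hf1 : ∀ n, ¬ n < 3 * c → f n = (e1 (n - 3 * c), 0) := fun n hn => if_neg hn
  have hg : ∀ x < 3 * c + b, ∀ y < 3 * c + b,
      ((f x).1 = (f y).1 ↔ designGroup c x = designGroup c y) := by
    intro x hx y hy
    unfold designGroup
    by_cases hxc : x < 3 * c <;> by_cases hyc : y < 3 * c
    · rw [hf3 x hxc, hf3 y hyc, if_pos hxc, if_pos hyc]
      exact ⟨fun h => i3 _ (by omega) _ (by omega) h, fun h => congrArg e3 h⟩
    · rw [hf3 x hxc, hf1 y hyc, if_pos hxc, if_neg hyc]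
      refine ⟨fun h => ?_, fun h => by omega⟩
      have a := (m3 (x / 3) (by omega)).2
      have b' := (m1 (y - 3 * c) (by omega)).2
      simp only at h
      rw [h] at a
      omega
    · rw [hf1 x hxc, hf3 y hyc, if_neg hxc, if_pos hyc]
      refine ⟨fun h => ?_, fun h => by omega⟩
      have a := (m3 (y / 3) (by omega)).2
      have b' := (m1 (x - 3 * c) (by omega)).2
      simp only at h
      rw [h] at b'
      omega
    · rw [hf1 x hxc, hf1 y hyc, if_neg hxc, if_neg hyc]
      refine ⟨fun h => ?_, fun h => by simp [h]⟩
      have := i1 _ (by omega) _ (by omega) h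
      omega
  refine ⟨f, ⟨?_, ?_, ?_⟩, hg⟩
  · intro n hn
    simp only [coe_range, Set.mem_Iio] at hn
    rw [mem_coe, mem_inflate]
    by_cases h : n < 3 * c
    · rw [hf3 n h]
      have := m3 (n / 3) (by omega)
      refine ⟨this.1, ?_⟩
      simp only [this.2]
      omega
    · rw [hf1 n h]
      have := m1 (n - 3 * c) (by omega)
      refine ⟨this.1, ?_⟩
      simp only [this.2]
      omega
  · intro x hx y hy hxy
    simp only [coe_range, Set.mem_Iio] at hx hy
    have h := (hg x hx y hy).1 (by rw [hxy])
    unfold designGroup at h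
    by_cases hxc : x < 3 * c <;> by_cases hyc : y < 3 * c
    · rw [hf3 x hxc, hf3 y hyc] at hxy
      simp only [hxc, hyc, if_true, Prod.mk.injEq] at h hxy
      omega
    · simp only [hxc, hyc, if_true, if_false] at h
      omega
    · simp only [hxc, hyc, if_true, if_false] at h
      omega
    · simpa only [hxc, hyc, if_false] using h
  · rintro ⟨q, j⟩ hq
    rw [mem_coe, mem_inflate] at hq
    obtain ⟨hqL, hj⟩ := hq
    simp only at hqL hj
    simp only [coe_range, Set.mem_image, Set.mem_Iio]
    rcases hw q hqL with h | h | h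
    · omega
    · obtain ⟨i, hi, rfl⟩ := s1 q hqL h
      refine ⟨3 * c + i, by omega, ?_⟩
      rw [hf1 _ (by omega)]
      have hj0 : j = 0 := by omega
      simp [hj0]
    · obtain ⟨i, hi, rfl⟩ := s3 q hqL h
      refine ⟨3 * i + j, by omega, ?_⟩
      rw [hf3 _ (by omega)]
      have a : (3 * i + j) / 3 = i := by omega
      have b' : (3 * i + j) % 3 = j := by omega
      rw [a, b']

theorem HasDesign.hasGDD {w : Q → ℕ} {L : Finset Q}
    (hw : ∀ q ∈ L, w q = 0 ∨ w q = 1 ∨ w q = 3) {b c : ℕ} (h : HasDesign b c)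
    (hb : (L.filter fun q => w q = 1).card = b) (hc : (L.filter fun q => w q = 3).card = c) :
    HasGDD w L := by
  rcases isEmpty_or_nonempty Q with hQ | ⟨⟨q₀⟩⟩
  · exact ⟨∅, by simp, fun x => (hQ.false x.1).elim⟩
  obtain ⟨f, hf, hg⟩ := exists_enumeration hw hb hc q₀
  obtain ⟨l, hl1, hl2⟩ := h
  have inj : ∀ x < 3 * c + b, ∀ y < 3 * c + b, f x = f y → x = y := fun x hx y hy h =>
    hf.injOn (by simpa using hx) (by simpa using hy) h
  have hmem : ∀ x < 3 * c + b, ∀ B ∈ l, (f x ∈ B.toFinset.image f ↔ x ∈ B) := by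
    intro x hx B hB
    simp only [mem_image, List.mem_toFinset]
    refine ⟨?_, fun h => ⟨x, h, rfl⟩⟩
    rintro ⟨y, hy, hyx⟩
    rwa [← inj y ((hl1 B hB).2.2.1 y hy) x hx hyx]
  refine ⟨(l.map fun B => B.toFinset.image f).toFinset, ?_, ?_⟩
  · intro B' hB'
    simp only [List.mem_toFinset, List.mem_map] at hB'
    obtain ⟨B, hB, rfl⟩ := hB'
    obtain ⟨hnd, hlen, hlt, htr⟩ := hl1 B hB
    refine ⟨?_, ?_, ?_⟩
    · intro x hx
      simp only [mem_image, List.mem_toFinset] at hx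
      obtain ⟨y, hy, rfl⟩ := hx
      exact hf.mapsTo (by simpa using hlt y hy)
    · rw [card_image_of_injOn, List.toFinset_card_of_nodup hnd]
      · simpa using hlen
      · intro x hx y hy hxy
        simp only [mem_coe, List.mem_toFinset] at hx hy
        exact inj x (hlt x hx) y (hlt y hy) hxy
    · intro x hx y hy hxy
      simp only [mem_image, List.mem_toFinset] at hx hy
      obtain ⟨x, hx, rfl⟩ := hx
      obtain ⟨y, hy, rfl⟩ := hy
      rw [htr x hx y hy ((hg x (hlt x hx) y (hlt y hy)).1 hxy)]
  · intro x hx y hy hxy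
    obtain ⟨x, hx', rfl⟩ := hf.surjOn hx
    obtain ⟨y, hy', rfl⟩ := hf.surjOn hy
    simp only [coe_range, Set.mem_Iio] at hx' hy'
    obtain ⟨B, hB⟩ := List.length_eq_one_iff.1
      (hl2 x hx' y hy' fun h => hxy ((hg x hx' y hy').2 h))
    have key : ∀ C, (C ∈ l ∧ x ∈ C ∧ y ∈ C) ↔ C = B := by
      intro C
      have := congrArg (C ∈ ·) hB
      simpa [List.mem_filter] using this
    obtain ⟨hBl, hxB, hyB⟩ := (key B).2 rfl
    refine ⟨B.toFinset.image f, ⟨?_, (hmem x hx' B hBl).2 hxB, (hmem y hy' B hBl).2 hyB⟩, ?_⟩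
    · simp only [List.mem_toFinset, List.mem_map]
      exact ⟨B, hBl, rfl⟩
    · rintro C' ⟨hC', hxC, hyC⟩
      simp only [List.mem_toFinset, List.mem_map] at hC'
      obtain ⟨C, hC, rfl⟩ := hC'
      rw [(key C).1 ⟨hC, (hmem x hx' C hC).1 hxC, (hmem y hy' C hC).1 hyC⟩]

/-- There is a `PBD(v,{3,4,5})` in which every three points lie in a flat of size at most `M`. -/
def HasSmallFlatPBD (v M : ℕ) : Prop :=
  ∃ Blocks : Finset (Finset (Fin v)), IsPBD Finset.univ ({3, 4, 5} : Set ℕ) Blocks ∧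
    ∀ S : Finset (Fin v), S.card = 3 →
      ∃ Y : Finset (Fin v), IsFlat Finset.univ Blocks Y ∧ S ⊆ Y ∧ Y.card ≤ M

theorem IsPBD.hasSmallFlatPBD {X : Type*} [DecidableEq X] {V : Finset X}
    {𝓑 : Finset (Finset X)} (h : IsPBD V ({3, 4, 5} : Set ℕ) 𝓑) {v M : ℕ} (hv : V.card = v)
    (hflat : ∀ x ∈ V, ∀ y ∈ V, ∀ z ∈ V, ∃ Y, IsFlat V 𝓑 Y ∧ x ∈ Y ∧ y ∈ Y ∧ z ∈ Y ∧ Y.card ≤ M) :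
    HasSmallFlatPBD v M := by
  let e : V ≃ Fin v := V.equivFinOfCardEq hv
  let g : Fin v → X := fun i => (e.symm i : X)
  have hgV : ∀ i, g i ∈ V := fun i => (e.symm i).2
  have ginj : Function.Injective g := Subtype.val_injective.comp e.symm.injective
  have gsurj : ∀ x ∈ V, ∃ i, g i = x := fun x hx => ⟨e ⟨x, hx⟩, by simp [g]⟩
  let φ : Finset X → Finset (Fin v) := fun B => univ.filter fun i => g i ∈ B
  have hφ : ∀ B i, i ∈ φ B ↔ g i ∈ B := fun B i => by simp [φ]
  have hcard : ∀ B ⊆ V, (φ B).card = B.card := by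
    intro B hB
    rw [← card_image_of_injective _ ginj]
    congr 1
    ext x
    simp only [mem_image, hφ]
    constructor
    · rintro ⟨i, hi, rfl⟩
      exact hi
    · intro hx
      obtain ⟨i, rfl⟩ := gsurj x (hB hx)
      exact ⟨i, hx, rfl⟩
  refine ⟨𝓑.image φ, ⟨?_, ?_⟩, ?_⟩
  · intro B' hB'
    obtain ⟨B, hB, rfl⟩ := mem_image.1 hB'
    obtain ⟨h1, h2⟩ := h.1 B hB
    exact ⟨subset_univ _, by rwa [hcard B h1]⟩
  · intro i _ j _ hij
    obtain ⟨B, ⟨hB, hi, hj⟩, huniq⟩ := h.2 (g i) (hgV i) (g j) (hgV j) (ginj.ne hij)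
    refine ⟨φ B, ⟨mem_image_of_mem _ hB, (hφ B i).2 hi, (hφ B j).2 hj⟩, ?_⟩
    rintro C' ⟨hC', hi', hj'⟩
    obtain ⟨C, hC, rfl⟩ := mem_image.1 hC'
    rw [huniq C ⟨hC, (hφ C i).1 hi', (hφ C j).1 hj'⟩]
  · intro S hS
    obtain ⟨i, j, k, -, -, -, rfl⟩ := card_eq_three.1 hS
    obtain ⟨Y, ⟨hYV, hY⟩, hi, hj, hk, hM⟩ := hflat (g i) (hgV i) (g j) (hgV j) (g k) (hgV k)
    refine ⟨φ Y, ⟨subset_univ _, ?_⟩, ?_, by rwa [hcard Y hYV]⟩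
    · intro a ha b hb hab
      obtain ⟨B, hB, haB, hbB, hBY⟩ := hY _ ((hφ Y a).1 ha) _ ((hφ Y b).1 hb) (ginj.ne hab)
      refine ⟨φ B, mem_image_of_mem _ hB, (hφ B a).2 haB, (hφ B b).2 hbB, ?_⟩
      intro t ht
      exact (hφ Y t).2 (hBY ((hφ B t).1 ht))
    · intro a ha
      simp only [mem_insert, mem_singleton] at ha
      rw [hφ]
      rcases ha with rfl | rfl | rfl <;> assumption

/-- Inflating the points of a linear space with line set `𝓛` by a weight function. -/
theorem hasSmallFlatPBD_of_linearSpace [Fintype Q] {w : Q → ℕ}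
    (hw : ∀ q, w q = 0 ∨ w q = 1 ∨ w q = 3) {𝓛 : Finset (Finset Q)}
    (h𝓛 : ∀ p q, p ≠ q → ∃! L, L ∈ 𝓛 ∧ p ∈ L ∧ q ∈ L) (hgdd : ∀ L ∈ 𝓛, HasGDD w L) {v M : ℕ}
    (hv : ∑ q, w q = v)
    (hflat : ∀ p q r : Q, ∃ T : Finset Q, p ∈ T ∧ q ∈ T ∧ r ∈ T ∧ ∑ q ∈ T, w q ≤ M ∧
      ∀ a ∈ T, ∀ b ∈ T, a ≠ b → ∃ L ∈ 𝓛, a ∈ L ∧ b ∈ L ∧ L ⊆ T) :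
    HasSmallFlatPBD v M := by
  choose! G hG1 hG2 using hgdd
  let F : Finset (Finset (Q × ℕ)) :=
    (univ.filter fun q => w q = 3).image fun q => {q} ×ˢ range 3
  have hF : ∀ B, B ∈ F ↔ ∃ q, w q = 3 ∧ {q} ×ˢ range 3 = B := by simp [F]
  have hU : ∀ B, B ∈ 𝓛.biUnion G ∪ F ↔ (∃ L ∈ 𝓛, B ∈ G L) ∨ ∃ q, w q = 3 ∧ {q} ×ˢ range 3 = B := by
    intro B
    rw [mem_union, mem_biUnion, hF]
  have three : ∀ x ∈ inflate w univ, ∀ y ∈ inflate w univ, x ≠ y → x.1 = y.1 → w x.1 = 3 := by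
    rintro ⟨p, i⟩ hx ⟨q, j⟩ hy hxy hpq
    rw [mem_inflate] at hx hy
    simp only at hpq hx hy
    subst hpq
    have : i ≠ j := fun h => hxy (by rw [h])
    rcases hw p with h | h | h <;> simp only [h] at * <;> omega
  have hpbd : IsPBD (inflate w univ) ({3, 4, 5} : Set ℕ) (𝓛.biUnion G ∪ F) := by
    refine ⟨?_, ?_⟩
    · intro B hB
      rcases (hU B).1 hB with ⟨L, hL, hBL⟩ | ⟨q, hq, rfl⟩
      · obtain ⟨h1, h2, -⟩ := hG1 L hL B hBL
        refine ⟨fun x hx => ?_, h2⟩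
        have := mem_inflate.1 (h1 hx)
        exact mem_inflate.2 ⟨mem_univ _, this.2⟩
      · refine ⟨?_, by simp⟩
        rintro ⟨p, i⟩ hx
        simp only [mem_product, mem_singleton, mem_range] at hx
        rw [mem_inflate]
        simp [hx.1, hq, hx.2]
    · intro x hx y hy hxy
      by_cases h : x.1 = y.1
      · have h3 := three x hx y hy hxy h
        have hx2 := (mem_inflate.1 hx).2
        have hy2 := (mem_inflate.1 hy).2
        rw [h3] at hx2
        rw [← h, h3] at hy2
        refine ⟨{x.1} ×ˢ range 3, ⟨(hU _).2 (Or.inr ⟨_, h3, rfl⟩), ?_, ?_⟩, ?_⟩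
        · simp [hx2]
        · simp [hy2, h]
        · rintro B ⟨hB, hxB, hyB⟩
          rcases (hU B).1 hB with ⟨L, hL, hBL⟩ | ⟨q, hq, rfl⟩
          · exact (hxy ((hG1 L hL B hBL).2.2 x hxB y hyB h)).elim
          · simp only [mem_product, mem_singleton] at hxB
            rw [hxB.1]
      · obtain ⟨L, ⟨hL, hxL, hyL⟩, huniq⟩ := h𝓛 x.1 y.1 h
        obtain ⟨B, ⟨hB, hxB, hyB⟩, hBu⟩ := hG2 L hL x
          (mem_inflate.2 ⟨hxL, (mem_inflate.1 hx).2⟩) y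
          (mem_inflate.2 ⟨hyL, (mem_inflate.1 hy).2⟩) h
        refine ⟨B, ⟨(hU B).2 (Or.inl ⟨L, hL, hB⟩), hxB, hyB⟩, ?_⟩
        rintro C ⟨hC, hxC, hyC⟩
        rcases (hU C).1 hC with ⟨L', hL', hCL⟩ | ⟨q, hq, rfl⟩
        · have hsub := (hG1 L' hL' C hCL).1
          have : L' = L :=
            huniq L' ⟨hL', (mem_inflate.1 (hsub hxC)).1, (mem_inflate.1 (hsub hyC)).1⟩
          subst this
          exact hBu C ⟨hCL, hxC, hyC⟩
        · simp only [mem_product, mem_singleton] at hxC hyC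
          exact (h (hxC.1.trans hyC.1.symm)).elim
  refine hpbd.hasSmallFlatPBD (by rw [card_inflate, hv]) ?_
  intro x hx y hy z hz
  obtain ⟨T, hxT, hyT, hzT, hM, hT⟩ := hflat x.1 y.1 z.1
  refine ⟨inflate w T, ⟨?_, ?_⟩, mem_inflate.2 ⟨hxT, (mem_inflate.1 hx).2⟩,
    mem_inflate.2 ⟨hyT, (mem_inflate.1 hy).2⟩, mem_inflate.2 ⟨hzT, (mem_inflate.1 hz).2⟩,
    by rwa [card_inflate]⟩
  · intro a ha
    exact mem_inflate.2 ⟨mem_univ _, (mem_inflate.1 ha).2⟩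
  · intro a ha b hb hab
    obtain ⟨haT, haw⟩ := mem_inflate.1 ha
    obtain ⟨hbT, hbw⟩ := mem_inflate.1 hb
    by_cases h : a.1 = b.1
    · have h3 := three a (mem_inflate.2 ⟨mem_univ _, haw⟩) b (mem_inflate.2 ⟨mem_univ _, hbw⟩) hab h
      rw [h3] at haw
      rw [← h, h3] at hbw
      refine ⟨{a.1} ×ˢ range 3, (hU _).2 (Or.inr ⟨_, h3, rfl⟩), ?_, ?_, ?_⟩
      · simp [haw]
      · simp [hbw, h]
      · rintro ⟨p, i⟩ hp
        simp only [mem_product, mem_singleton, mem_range] at hp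
        rw [mem_inflate]
        simp [hp.1, haT, h3, hp.2]
    · obtain ⟨L, hL, haL, hbL, hLT⟩ := hT _ haT _ hbT h
      obtain ⟨B, ⟨hB, haB, hbB⟩, -⟩ := hG2 L hL a (mem_inflate.2 ⟨haL, haw⟩) b
        (mem_inflate.2 ⟨hbL, hbw⟩) h
      refine ⟨B, (hU B).2 (Or.inl ⟨L, hL, hB⟩), haB, hbB, ?_⟩
      intro t ht
      obtain ⟨h1, h2⟩ := mem_inflate.1 ((hG1 L hL B hB).1 ht)
      exact mem_inflate.2 ⟨hLT h1, h2⟩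

end Inflation

section Weights

variable {Q : Type*} [DecidableEq Q]

/-- Weight three on `T`, weight zero on `Z`, weight one elsewhere. -/
def weight (Z T : Finset Q) (q : Q) : ℕ := if q ∈ T then 3 else if q ∈ Z then 0 else 1

theorem weight_eq (Z T : Finset Q) (q : Q) :
    weight Z T q = 0 ∨ weight Z T q = 1 ∨ weight Z T q = 3 := by
  unfold weight
  split_ifs <;> simp

theorem sum_weight {Z T : Finset Q} (h : Disjoint Z T) (A : Finset Q) :
    ∑ q ∈ A, weight Z T q + (A ∩ Z).card = A.card + 2 * (A ∩ T).card := by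
  have h1 : ∀ B : Finset Q, (A ∩ B).card = ∑ q ∈ A, if q ∈ B then 1 else 0 := fun B => by
    rw [← filter_mem_eq_inter, card_filter]
  rw [h1, h1, card_eq_sum_ones, mul_sum, ← sum_add_distrib, ← sum_add_distrib]
  refine sum_congr rfl fun q _ => ?_
  have hq : q ∈ Z → q ∉ T := fun hz => disjoint_left.1 h hz
  unfold weight
  by_cases hT : q ∈ T <;> by_cases hZ : q ∈ Z <;> simp_all

theorem HasDesign.hasGDD_weight {b c : ℕ} (hd : HasDesign b c) {Z T : Finset Q}
    (h : Disjoint Z T) {L : Finset Q} (hc : (L ∩ T).card = c)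
    (hb : b + c + (L ∩ Z).card = L.card) : HasGDD (weight Z T) L := by
  have h3 : (L.filter fun q => weight Z T q = 3) = L ∩ T := by
    ext q
    rw [mem_filter, mem_inter]
    unfold weight
    split_ifs <;> simp_all
  have h1 : (L.filter fun q => weight Z T q = 1) = L \ ((L ∩ T) ∪ (L ∩ Z)) := by
    ext q
    simp only [mem_filter, mem_sdiff, mem_union, mem_inter]
    unfold weight
    split_ifs <;> simp_all
  refine hd.hasGDD (fun q _ => weight_eq Z T q) ?_ (by rw [h3, hc])
  rw [h1, card_sdiff_of_subset (union_subset inter_subset_left inter_subset_left),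
    card_union_of_disjoint]
  · omega
  · exact (h.symm.mono inter_subset_right inter_subset_right)

end Weights

section Geometry

variable {K V : Type*} [Field K] [AddCommGroup V] [Module K V] [Finite V]

/-- The points of projective space that lie in a given linear subspace. -/
noncomputable def pts (W : Submodule K V) : Finset (ℙ K V) :=
  (Set.toFinite {p : ℙ K V | p.submodule ≤ W}).toFinset

theorem mem_pts {W : Submodule K V} {p : ℙ K V} : p ∈ pts W ↔ p.submodule ≤ W := by
  simp [pts]

theorem card_pts [Finite K] (W : Submodule K V) :
    (pts W).card = ∑ i ∈ range (finrank K W), Nat.card K ^ i := by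
  have inj := Projectivization.map_injective W.subtype W.injective_subtype
  rw [← Projectivization.card_of_finrank K W rfl, ← Nat.card_range_of_injective inj,
    Nat.card_coe_set_eq, ← Set.ncard_coe_finset]
  congr 1
  ext p
  rw [mem_coe, mem_pts]
  constructor
  · induction p with | h u hu =>
    intro h
    rw [Projectivization.submodule_mk, Submodule.span_singleton_le_iff_mem] at h
    exact ⟨Projectivization.mk K (⟨u, h⟩ : W) fun h0 => hu (congrArg Subtype.val h0), rfl⟩
  · rintro ⟨q, rfl⟩
    induction q with | h u hu =>
    rw [Projectivization.map_mk, Projectivization.submodule_mk,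
      Submodule.span_singleton_le_iff_mem]
    exact u.2

theorem pts_inter [DecidableEq (ℙ K V)] (U W : Submodule K V) :
    pts U ∩ pts W = pts (U ⊓ W) := by
  ext p
  rw [mem_inter, mem_pts, mem_pts, mem_pts, le_inf_iff]

theorem pts_mono {U W : Submodule K V} (h : U ≤ W) : pts U ⊆ pts W := fun _ hp =>
  mem_pts.2 ((mem_pts.1 hp).trans h)

theorem pts_bot : pts (⊥ : Submodule K V) = ∅ := by
  refine eq_empty_of_forall_notMem fun p hp => ?_
  have h := p.finrank_submodule
  rw [le_bot_iff.1 (mem_pts.1 hp), finrank_bot] at h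
  omega

theorem finrank_sup_submodule {W : Submodule K V} {p : ℙ K V} (h : ¬ p.submodule ≤ W) :
    finrank K (W ⊔ p.submodule : Submodule K V) = finrank K W + 1 := by
  have h1 := Submodule.finrank_sup_add_finrank_inf_eq W p.submodule
  have h2 : finrank K (W ⊓ p.submodule : Submodule K V) < finrank K p.submodule :=
    Submodule.finrank_lt_finrank_of_lt (lt_of_le_of_ne inf_le_right fun h' => h (inf_eq_right.1 h'))
  rw [p.finrank_submodule] at h1 h2
  omega

theorem finrank_sup_submodule_le (W : Submodule K V) (p : ℙ K V) :
    finrank K (W ⊔ p.submodule : Submodule K V) ≤ finrank K W + 1 := by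
  have h1 := Submodule.finrank_sup_add_finrank_inf_eq W p.submodule
  rw [p.finrank_submodule] at h1
  omega

omit [Finite V] in
theorem submodule_le_submodule {p q : ℙ K V} (h : p.submodule ≤ q.submodule) : p = q :=
  Projectivization.submodule_injective <|
    Submodule.eq_of_le_of_finrank_eq h (by rw [p.finrank_submodule, q.finrank_submodule])

theorem finrank_line {p q : ℙ K V} (h : p ≠ q) :
    finrank K (p.submodule ⊔ q.submodule : Submodule K V) = 2 := by
  rw [finrank_sup_submodule fun h' => h (submodule_le_submodule h').symm, p.finrank_submodule]

theorem line_eq {p q : ℙ K V} (h : p ≠ q) {W : Submodule K V} (hW : finrank K W = 2)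
    (hp : p ∈ pts W) (hq : q ∈ pts W) : p.submodule ⊔ q.submodule = W :=
  Submodule.eq_of_le_of_finrank_eq (sup_le (mem_pts.1 hp) (mem_pts.1 hq))
    (by rw [finrank_line h, hW])

theorem card_line_inter_le_one [DecidableEq (ℙ K V)] {W S : Submodule K V}
    (hW : finrank K W = 2) (h : ¬ W ≤ S) : (pts W ∩ pts S).card ≤ 1 := by
  rw [card_le_one]
  intro p hp q hq
  rw [mem_inter] at hp hq
  by_contra hpq
  refine h ?_
  rw [← line_eq hpq hW hp.1 hq.1]
  exact sup_le (mem_pts.1 hp.2) (mem_pts.1 hq.2)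

theorem exists_submodule_finrank_eq (U : Submodule K V) {k : ℕ} (h1 : finrank K U ≤ k)
    (h2 : k ≤ finrank K V) : ∃ W, U ≤ W ∧ finrank K W = k := by
  induction k, h1 using Nat.le_induction with
  | base => exact ⟨U, le_rfl, rfl⟩
  | succ k _ ih =>
    obtain ⟨W, hUW, hW⟩ := ih (by omega)
    have hne : W < ⊤ := lt_top_iff_ne_top.2 fun h => by
      rw [h, finrank_top] at hW
      omega
    obtain ⟨u, -, hu⟩ := SetLike.exists_of_lt hne
    have hu0 : u ≠ 0 := fun h => hu (h ▸ W.zero_mem)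
    refine ⟨W ⊔ (Projectivization.mk K u hu0).submodule, hUW.trans le_sup_left, ?_⟩
    rw [finrank_sup_submodule, hW]
    rwa [Projectivization.submodule_mk, Submodule.span_singleton_le_iff_mem]

theorem finrank_inf_hyperplane {H W : Submodule K V} (hH : finrank K H + 1 = finrank K V)
    (hW : ¬ W ≤ H) : finrank K (W ⊓ H : Submodule K V) + 1 = finrank K W := by
  have h1 := Submodule.finrank_sup_add_finrank_inf_eq W H
  have h2 : finrank K H < finrank K (W ⊔ H : Submodule K V) :=
    Submodule.finrank_lt_finrank_of_lt (lt_of_le_of_ne le_sup_right fun h => hW (by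
      rw [h]
      exact le_sup_left))
  have h3 := Submodule.finrank_le (W ⊔ H)
  omega

/-- Inflation of projective space in which all lines inside the subspace `S` are replaced by a
single block `S`. -/
theorem hasSmallFlatPBD_projective [DecidableEq (ℙ K V)] {w : ℙ K V → ℕ}
    (hw : ∀ q, w q = 0 ∨ w q = 1 ∨ w q = 3) {S : Submodule K V} (hS3 : finrank K S ≤ 3)
    (hline : ∀ W : Submodule K V, finrank K W = 2 → ¬ W ≤ S → HasGDD w (pts W))
    (hS : HasGDD w (pts S)) {v M : ℕ} (hv : ∑ q ∈ pts (⊤ : Submodule K V), w q = v)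
    (h3 : ∀ W : Submodule K V, finrank K W ≤ 3 → ∑ q ∈ pts W, w q ≤ M)
    (h4 : 2 ≤ finrank K S →
      ∀ W : Submodule K V, S ≤ W → finrank K W ≤ 4 → ∑ q ∈ pts W, w q ≤ M) :
    HasSmallFlatPBD v M := by
  have : Fintype (ℙ K V) := Fintype.ofFinite _
  have htop : pts (⊤ : Submodule K V) = univ := by
    ext p
    simp [mem_pts]
  let P : Finset (ℙ K V) → Prop := fun L =>
    L = pts S ∨ ∃ W : Submodule K V, finrank K W = 2 ∧ ¬ W ≤ S ∧ L = pts W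
  have hP : ∀ L, L ∈ (Set.toFinite {L | P L}).toFinset ↔ P L := fun L => by simp
  refine hasSmallFlatPBD_of_linearSpace hw (𝓛 := (Set.toFinite {L | P L}).toFinset) ?_ ?_
    (htop ▸ hv) ?_
  · intro p q hpq
    by_cases h : p ∈ pts S ∧ q ∈ pts S
    · refine ⟨pts S, ⟨(hP _).2 (Or.inl rfl), h.1, h.2⟩, ?_⟩
      rintro L ⟨hL, hp, hq⟩
      rcases (hP L).1 hL with rfl | ⟨W, hW, hWS, rfl⟩
      · rfl
      · refine (hWS ?_).elim
        rw [← line_eq hpq hW hp hq]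
        exact sup_le (mem_pts.1 h.1) (mem_pts.1 h.2)
    · refine ⟨pts (p.submodule ⊔ q.submodule), ⟨(hP _).2 (Or.inr ⟨_, finrank_line hpq, ?_, rfl⟩),
        mem_pts.2 le_sup_left, mem_pts.2 le_sup_right⟩, ?_⟩
      · intro h'
        exact h ⟨mem_pts.2 (le_sup_left.trans h'), mem_pts.2 (le_sup_right.trans h')⟩
      · rintro L ⟨hL, hp, hq⟩
        rcases (hP L).1 hL with rfl | ⟨W, hW, hWS, rfl⟩
        · exact (h ⟨hp, hq⟩).elim
        · rw [line_eq hpq hW hp hq]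
  · intro L hL
    rcases (hP L).1 hL with rfl | ⟨W, hW, hWS, rfl⟩
    · exact hS
    · exact hline W hW hWS
  · intro p q r
    have key : ∀ U : Submodule K V, S ≤ U ∨ finrank K (U ⊓ S : Submodule K V) ≤ 1 →
        ∀ a ∈ pts U, ∀ b ∈ pts U, a ≠ b →
          ∃ L ∈ (Set.toFinite {L | P L}).toFinset, a ∈ L ∧ b ∈ L ∧ L ⊆ pts U := by
      intro U hU a ha b hb hab
      have hle : a.submodule ⊔ b.submodule ≤ U := sup_le (mem_pts.1 ha) (mem_pts.1 hb)
      by_cases h : a.submodule ⊔ b.submodule ≤ S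
      · rcases hU with hU | hU
        · exact ⟨pts S, (hP _).2 (Or.inl rfl), mem_pts.2 (le_sup_left.trans h),
            mem_pts.2 (le_sup_right.trans h), pts_mono hU⟩
        · have := Submodule.finrank_mono (le_inf hle h)
          rw [finrank_line hab] at this
          omega
      · exact ⟨pts (a.submodule ⊔ b.submodule), (hP _).2 (Or.inr ⟨_, finrank_line hab, h, rfl⟩),
          mem_pts.2 le_sup_left, mem_pts.2 le_sup_right, pts_mono hle⟩
    let U := p.submodule ⊔ q.submodule ⊔ r.submodule
    have hU3 : finrank K U ≤ 3 := by
      have h1 := finrank_sup_submodule_le p.submodule q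
      have h2 := finrank_sup_submodule_le (p.submodule ⊔ q.submodule) r
      rw [p.finrank_submodule] at h1
      exact h2.trans (by omega)
    have hp : p ∈ pts U := mem_pts.2 (le_sup_left.trans le_sup_left)
    have hq : q ∈ pts U := mem_pts.2 (le_sup_right.trans le_sup_left)
    have hr : r ∈ pts U := mem_pts.2 le_sup_right
    by_cases h : finrank K (U ⊓ S : Submodule K V) ≤ 1
    · exact ⟨pts U, hp, hq, hr, h3 U hU3, key U (Or.inr h)⟩
    · have hsub : pts U ⊆ pts (U ⊔ S) := pts_mono le_sup_left
      refine ⟨pts (U ⊔ S), hsub hp, hsub hq, hsub hr, h4 ?_ _ le_sup_right ?_,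
        key _ (Or.inl le_sup_right)⟩
      · have := Submodule.finrank_mono (inf_le_right : U ⊓ S ≤ S)
        omega
      · have := Submodule.finrank_sup_add_finrank_inf_eq U S
        omega

end Geometry

theorem exists_transversal_subset {Q : Type*} [DecidableEq Q] (𝓒 : Finset (Finset Q))
    (hcard : ∀ C ∈ 𝓒, C.card = 4) (hdisj : ∀ C ∈ 𝓒, ∀ D ∈ 𝓒, C ≠ D → Disjoint C D) :
    ∀ t ≤ 4 * 𝓒.card, t ≠ 1 → t ≠ 2 → t ≠ 5 → ∃ T ⊆ 𝓒.biUnion id, T.card = t ∧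
      ∀ C ∈ 𝓒, (C ∩ T).card = 0 ∨ (C ∩ T).card = 3 ∨ (C ∩ T).card = 4 := by
  induction 𝓒 using Finset.induction_on with
  | empty =>
    intro t ht _ _ _
    exact ⟨∅, by simp, by simp at ht ⊢; omega, by simp⟩
  | insert D 𝓓 hD ih =>
    intro t ht h1 h2 h5
    rw [card_insert_of_notMem hD] at ht
    have ih' := ih (fun C hC => hcard C (mem_insert_of_mem hC))
      (fun C hC E hE => hdisj C (mem_insert_of_mem hC) E (mem_insert_of_mem hE))
    have hDd : ∀ C ∈ 𝓓, Disjoint C D := fun C hC =>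
      hdisj C (mem_insert_of_mem hC) D (mem_insert_self _ _) fun h => hD (h ▸ hC)
    have hUD : Disjoint (𝓓.biUnion id) D := (disjoint_biUnion_left _ _ _).2 hDd
    have extend : ∀ s k, s ≤ 4 * 𝓓.card → s ≠ 1 → s ≠ 2 → s ≠ 5 → (k = 0 ∨ k = 3 ∨ k = 4) →
        s + k = t → ∃ T ⊆ (insert D 𝓓).biUnion id, T.card = t ∧
          ∀ C ∈ insert D 𝓓, (C ∩ T).card = 0 ∨ (C ∩ T).card = 3 ∨ (C ∩ T).card = 4 := by
      intro s k hs hs1 hs2 hs5 hk hsk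
      obtain ⟨T, hT, hTs, hTC⟩ := ih' s hs hs1 hs2 hs5
      obtain ⟨A, hAD, hA⟩ := exists_subset_card_eq
        (show k ≤ D.card by rw [hcard D (mem_insert_self _ _)]; omega)
      have hTA : Disjoint T A := hUD.mono hT hAD
      refine ⟨T ∪ A, ?_, by rw [card_union_of_disjoint hTA]; omega, ?_⟩
      · rw [biUnion_insert]
        exact union_subset (hT.trans subset_union_right) (hAD.trans subset_union_left)
      · intro C hC
        rw [inter_union_distrib_left]
        rcases mem_insert.1 hC with rfl | hC
        · rw [disjoint_iff_inter_eq_empty.1 (hUD.mono_left hT).symm, empty_union,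
            inter_eq_right.2 hAD, hA]
          exact hk
        · rw [disjoint_iff_inter_eq_empty.1 ((hDd C hC).mono_right hAD), union_empty]
          exact hTC C hC
    by_cases h0 : t = 0 ∨ t = 3
    · exact extend 0 t (by omega) (by omega) (by omega) (by omega) (by omega) (by omega)
    by_cases h6 : t = 6 ∨ t = 9
    · exact extend (t - 3) 3 (by omega) (by omega) (by omega) (by omega) (by omega) (by omega)
    · exact extend (t - 4) 4 (by omega) (by omega) (by omega) (by omega) (by omega) (by omega)

section Cases

variable {K V : Type*} [Field K] [Finite K] [AddCommGroup V] [Module K V] [Finite V]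

theorem card_pts_of_finrank (hK : Nat.card K = 4) {W : Submodule K V} {k : ℕ}
    (hW : finrank K W = k) : (pts W).card = ∑ i ∈ range k, 4 ^ i := by
  rw [card_pts, hW, hK]

theorem card_pts_le (hK : Nat.card K = 4) {W : Submodule K V} {k : ℕ}
    (hW : finrank K W ≤ k) : (pts W).card ≤ ∑ i ∈ range k, 4 ^ i := by
  rw [card_pts, hK]
  exact sum_le_sum_of_subset (range_mono hW)

theorem sum_weight_plane_le [DecidableEq (ℙ K V)] (hK : Nat.card K = 4)
    (Z T : Finset (ℙ K V)) {W : Submodule K V} (hW : finrank K W ≤ 3) :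
    ∑ q ∈ pts W, weight Z T q ≤ 63 := by
  have h1 : ∑ q ∈ pts W, weight Z T q ≤ (pts W).card • 3 := sum_le_card_nsmul _ _ _ fun q _ => by
    rcases weight_eq Z T q with h | h | h <;> omega
  have h2 := card_pts_le hK hW
  simp [sum_range_succ] at h2
  rw [smul_eq_mul] at h1
  omega

theorem hasSmallFlatPBD_lines [DecidableEq (ℙ K V)] (hK : Nat.card K = 4)
    {Z T : Finset (ℙ K V)} (hZT : Disjoint Z T)
    (hline : ∀ W : Submodule K V, finrank K W = 2 → HasGDD (weight Z T) (pts W)) {v : ℕ}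
    (hv : ∑ q ∈ pts (⊤ : Submodule K V), weight Z T q = v) : HasSmallFlatPBD v 63 := by
  refine hasSmallFlatPBD_projective (weight_eq Z T) (S := ⊥) (by simp) (fun W hW _ => hline W hW)
    ?_ hv (fun W hW => sum_weight_plane_le hK Z T hW) (fun h => by simp at h)
  exact hasDesign_0_0.hasGDD_weight hZT (by simp [pts_bot]) (by simp [pts_bot])

theorem hasDesign_of_add_eq_five {b c : ℕ} (h : b + c = 5) : HasDesign b c := by
  have hc : c ≤ 5 := by omega
  obtain rfl : b = 5 - c := by omega
  interval_cases c
  exacts [hasDesign_5_0, hasDesign_4_1, hasDesign_3_2, hasDesign_2_3, hasDesign_1_4, hasDesign_0_5]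

theorem hasSmallFlatPBD_even (hK : Nat.card K = 4) {t : ℕ}
    (ht : t ≤ (pts (⊤ : Submodule K V)).card) :
    HasSmallFlatPBD ((pts (⊤ : Submodule K V)).card + 2 * t) 63 := by
  classical
  obtain ⟨T, hT, rfl⟩ := exists_subset_card_eq ht
  refine hasSmallFlatPBD_lines hK (disjoint_empty_left T) (fun W hW => ?_) ?_
  · have h5 : (pts W).card = 5 := by simp [card_pts_of_finrank hK hW, sum_range_succ]
    have := card_le_card (inter_subset_left : pts W ∩ T ⊆ pts W)
    exact (hasDesign_of_add_eq_five (b := 5 - (pts W ∩ T).card) (by omega)).hasGDD_weight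
      (disjoint_empty_left T) rfl (by simp; omega)
  · have := sum_weight (disjoint_empty_left T) (pts (⊤ : Submodule K V))
    rw [inter_eq_right.2 hT] at this
    simpa using this

theorem hasSmallFlatPBD_odd (hK : Nat.card K = 4) {t : ℕ}
    (ht : t < (pts (⊤ : Submodule K V)).card) (h1 : t ≠ 1) (h2 : t ≠ 2) (h5 : t ≠ 5) {v : ℕ}
    (hv : v + 1 = (pts (⊤ : Submodule K V)).card + 2 * t) : HasSmallFlatPBD v 63 := by
  classical
  obtain ⟨z, hz⟩ := card_pos.1 (by omega : 0 < (pts (⊤ : Submodule K V)).card)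
  let line : ℙ K V → Submodule K V := fun q => z.submodule ⊔ q.submodule
  let 𝓒 := ((pts (⊤ : Submodule K V)).erase z).image fun q => (pts (line q)).erase z
  have hzl : ∀ q, z ∈ pts (line q) := fun q => mem_pts.2 le_sup_left
  have hql : ∀ q, q ∈ pts (line q) := fun q => mem_pts.2 le_sup_right
  have hrank : ∀ q, q ≠ z → finrank K (line q) = 2 := fun q hq => finrank_line hq.symm
  have h𝓒 : ∀ C, C ∈ 𝓒 ↔ ∃ q, q ≠ z ∧ (pts (line q)).erase z = C := by
    intro C
    simp [𝓒, mem_pts]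
  have hcard : ∀ C ∈ 𝓒, C.card = 4 := by
    intro C hC
    obtain ⟨q, hq, rfl⟩ := (h𝓒 C).1 hC
    rw [card_erase_of_mem (hzl q), card_pts_of_finrank hK (hrank q hq)]
    simp [sum_range_succ]
  have hdisj : ∀ C ∈ 𝓒, ∀ D ∈ 𝓒, C ≠ D → Disjoint C D := by
    intro C hC D hD hCD
    obtain ⟨p, hp, rfl⟩ := (h𝓒 C).1 hC
    obtain ⟨q, hq, rfl⟩ := (h𝓒 D).1 hD
    rw [Finset.disjoint_left]
    intro r hr hr'
    rw [mem_erase] at hr hr'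
    refine hCD ?_
    rw [← line_eq hr.1.symm (hrank p hp) (hzl p) hr.2,
      ← line_eq hr.1.symm (hrank q hq) (hzl q) hr'.2]
  have hunion : 𝓒.biUnion id = (pts (⊤ : Submodule K V)).erase z := by
    ext q
    rw [mem_biUnion, mem_erase]
    constructor
    · rintro ⟨C, hC, hq⟩
      obtain ⟨p, hp, rfl⟩ := (h𝓒 C).1 hC
      exact ⟨(mem_erase.1 hq).1, mem_pts.2 le_top⟩
    · rintro ⟨hq, -⟩
      exact ⟨_, (h𝓒 _).2 ⟨q, hq, rfl⟩, mem_erase.2 ⟨hq, hql q⟩⟩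
  have hN : 4 * 𝓒.card + 1 = (pts (⊤ : Submodule K V)).card := by
    have h := card_biUnion (t := id) fun C hC D hD h => hdisj C hC D hD h
    have h' : ∑ C ∈ 𝓒, (id C : Finset (ℙ K V)).card = 𝓒.card * 4 := sum_const_nat hcard
    rw [← card_erase_add_one hz, ← hunion]
    omega
  obtain ⟨T, hT, hTt, hTC⟩ := exists_transversal_subset 𝓒 hcard hdisj t (by omega) h1 h2 h5
  rw [hunion] at hT
  have hzT : Disjoint {z} T := by
    rw [disjoint_singleton_left]
    exact fun h => (mem_erase.1 (hT h)).1 rfl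
  refine hasSmallFlatPBD_lines hK hzT (fun W hW => ?_) ?_
  · have hW5 : (pts W).card = 5 := by simp [card_pts_of_finrank hK hW, sum_range_succ]
    by_cases hzW : z ∈ pts W
    · have hWz : (pts W ∩ {z}).card = 1 := by rw [inter_singleton_of_mem hzW, card_singleton]
      obtain ⟨q, hq⟩ := card_pos.1
        (by rw [card_erase_of_mem hzW]; omega : 0 < ((pts W).erase z).card)
      obtain ⟨hqz, hqW⟩ := mem_erase.1 hq
      have hlW : line q = W := line_eq hqz.symm hW hzW hqW
      have hWT : pts W ∩ T = (pts W).erase z ∩ T := by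
        rw [erase_inter, erase_eq_of_notMem]
        exact fun h => disjoint_singleton_left.1 hzT (mem_inter.1 h).2
      have hcases := hTC _ ((h𝓒 _).2 ⟨q, hqz, rfl⟩)
      rw [hlW, ← hWT] at hcases
      rcases hcases with h | h | h
      · exact hasDesign_4_0.hasGDD_weight hzT h (by omega)
      · exact hasDesign_1_3.hasGDD_weight hzT h (by omega)
      · exact hasDesign_0_4.hasGDD_weight hzT h (by omega)
    · have hWz : (pts W ∩ {z}).card = 0 := by rw [inter_singleton_of_notMem hzW, card_empty]
      have := card_le_card (inter_subset_left : pts W ∩ T ⊆ pts W)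
      exact (hasDesign_of_add_eq_five (b := 5 - (pts W ∩ T).card) (by omega)).hasGDD_weight
        hzT rfl (by omega)
  · have := sum_weight hzT (pts (⊤ : Submodule K V))
    rw [inter_eq_right.2 (hT.trans (erase_subset _ _)), inter_singleton_of_mem hz, card_singleton,
      hTt] at this
    omega

/-- Affine space of dimension one more, with two points deleted and a plane rebuilt. -/
theorem hasSmallFlatPBD_affine (hK : Nat.card K = 4) {n : ℕ} (hn : 2 ≤ n)
    (hV : finrank K V = n + 1) : HasSmallFlatPBD (4 ^ n - 2) 63 := by
  classical
  obtain ⟨H, -, hH⟩ := exists_submodule_finrank_eq (⊥ : Submodule K V) (k := n) (by simp) (by omega)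
  have hH1 : finrank K H + 1 = finrank K V := by omega
  have htop : (pts (⊤ : Submodule K V)).card = ∑ i ∈ range (n + 1), 4 ^ i :=
    card_pts_of_finrank hK (by rw [finrank_top, hV])
  have hHcard := card_pts_of_finrank hK hH
  rw [sum_range_succ, ← hHcard] at htop
  have h4n : 4 ^ 2 ≤ 4 ^ n := Nat.pow_le_pow_right (by norm_num) hn
  obtain ⟨x, hx, y, hy, hxy⟩ := one_lt_card.1
    (by rw [card_sdiff_of_subset (pts_mono le_top)]; omega :
      1 < (pts (⊤ : Submodule K V) \ pts H).card)
  rw [mem_sdiff] at hx hy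
  obtain ⟨S, hlS, hS⟩ := exists_submodule_finrank_eq (x.submodule ⊔ y.submodule) (k := 3)
    (by rw [finrank_line hxy]; omega) (by omega)
  have hxS : x ∈ pts S := mem_pts.2 (le_sup_left.trans hlS)
  have hyS : y ∈ pts S := mem_pts.2 (le_sup_right.trans hlS)
  have hpair : ({x, y} : Finset (ℙ K V)).card = 2 := card_pair hxy
  have hd : Disjoint (pts H) {x, y} := by
    rw [disjoint_insert_right, disjoint_singleton_right]
    exact ⟨hx.2, hy.2⟩
  have hZ : ∀ A : Finset (ℙ K V),
      (A ∩ (pts H ∪ {x, y})).card = (A ∩ pts H).card + (A ∩ {x, y}).card := fun A => by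
    rw [inter_union_distrib_left, card_union_of_disjoint]
    exact hd.mono inter_subset_right inter_subset_right
  have hZT : Disjoint (pts H ∪ {x, y}) ∅ := disjoint_empty_right _
  have hnot : ∀ W, S ≤ W → ¬ W ≤ H := fun W hSW hWH =>
    hx.2 (mem_pts.2 ((mem_pts.1 hxS).trans (hSW.trans hWH)))
  have hfull : ∀ W, S ≤ W → (pts W ∩ (pts H ∪ {x, y})).card =
      (∑ i ∈ range (finrank K W - 1), 4 ^ i) + 2 := by
    intro W hSW
    have h := finrank_inf_hyperplane hH1 (hnot W hSW)
    rw [hZ, pts_inter, card_pts_of_finrank hK rfl, inter_eq_right.2, hpair]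
    · congr 3
      omega
    · exact insert_subset (pts_mono hSW hxS) (singleton_subset_iff.2 (pts_mono hSW hyS))
  refine hasSmallFlatPBD_projective (weight_eq (pts H ∪ {x, y}) ∅) hS.le ?_ ?_ ?_
    (fun W hW => sum_weight_plane_le hK _ _ hW) ?_
  · intro W hW hWS
    have hW5 : (pts W).card = 5 := by simp [card_pts_of_finrank hK hW, sum_range_succ]
    by_cases hWH : W ≤ H
    · refine hasDesign_0_0.hasGDD_weight hZT (by simp) ?_
      rw [inter_eq_left.2 ((pts_mono hWH).trans subset_union_left)]
      simp
    · have h1 : (pts W ∩ pts H).card = 1 := by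
        have h := finrank_inf_hyperplane hH1 hWH
        rw [pts_inter, card_pts_of_finrank hK (k := 1) (by omega)]
        simp
      have h2 : (pts W ∩ {x, y}).card ≤ 1 :=
        (card_le_card (inter_subset_inter_left
          (insert_subset hxS (singleton_subset_iff.2 hyS)))).trans (card_line_inter_le_one hW hWS)
      have hZW := hZ (pts W)
      interval_cases h : (pts W ∩ {x, y}).card
      · exact hasDesign_4_0.hasGDD_weight hZT (by simp) (by omega)
      · exact hasDesign_3_0.hasGDD_weight hZT (by simp) (by omega)
  · refine hasDesign_14_0.hasGDD_weight hZT (by simp) ?_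
    rw [hfull S le_rfl, card_pts_of_finrank hK hS, hS]
    simp [sum_range_succ]
  · have h := sum_weight hZT (pts (⊤ : Submodule K V))
    rw [hfull ⊤ le_top, finrank_top, hV, htop, Nat.add_sub_cancel, ← hHcard] at h
    simp only [inter_empty, card_empty] at h
    omega
  · intro _ W hSW hW4
    have h3 := Submodule.finrank_mono hSW
    have h := sum_weight hZT (pts W)
    rw [hfull W hSW, card_pts, hK] at h
    rw [hS] at h3
    simp only [inter_empty, card_empty] at h
    obtain hW | hW : finrank K W = 3 ∨ finrank K W = 4 := by omega
    all_goals
      rw [hW] at h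
      norm_num only [sum_range_succ, sum_range_zero] at h
      omega

/-- One plane is rebuilt with one point deleted and `c` points tripled. -/
theorem hasSmallFlatPBD_exceptional (hK : Nat.card K = 4) (hV : 3 ≤ finrank K V) {b c : ℕ}
    (hbc : HasDesign b c) (hb : b + c = 20) (hc : c ≤ 5) {v : ℕ}
    (hv : v + 1 = (pts (⊤ : Submodule K V)).card + 2 * c) : HasSmallFlatPBD v 94 := by
  classical
  obtain ⟨S, -, hS⟩ := exists_submodule_finrank_eq (⊥ : Submodule K V) (k := 3) (by simp) hV
  have hS21 : (pts S).card = 21 := by simp [card_pts_of_finrank hK hS, sum_range_succ]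
  obtain ⟨z, hz⟩ := card_pos.1 (by omega : 0 < (pts S).card)
  obtain ⟨T, hT, hTc⟩ := exists_subset_card_eq
    (show c ≤ ((pts S).erase z).card by rw [card_erase_of_mem hz]; omega)
  have hTS : T ⊆ pts S := hT.trans (erase_subset _ _)
  have hzT : Disjoint {z} T := by
    rw [disjoint_singleton_left]
    exact fun h => (mem_erase.1 (hT h)).1 rfl
  have hsum : ∀ W, S ≤ W → ∑ q ∈ pts W, weight {z} T q + 1 = (pts W).card + 2 * c := by
    intro W hSW
    have h := sum_weight hzT (pts W)
    rwa [inter_eq_right.2 (hTS.trans (pts_mono hSW)), inter_singleton_of_mem (pts_mono hSW hz),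
      card_singleton, hTc] at h
  refine hasSmallFlatPBD_projective (weight_eq {z} T) hS.le ?_ ?_ ?_
    (fun W hW => (sum_weight_plane_le hK _ _ hW).trans (by norm_num)) ?_
  · intro W hW hWS
    have hW5 : (pts W).card = 5 := by simp [card_pts_of_finrank hK hW, sum_range_succ]
    have h1 : (pts W ∩ {z}).card + (pts W ∩ T).card ≤ 1 := by
      rw [← card_union_of_disjoint (hzT.mono inter_subset_right inter_subset_right),
        ← inter_union_distrib_left]
      exact (card_le_card (inter_subset_inter_left
        (union_subset (singleton_subset_iff.2 hz) hTS))).trans (card_line_inter_le_one hW hWS)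
    obtain ⟨h2, h3⟩ | ⟨h2, h3⟩ | ⟨h2, h3⟩ :
        ((pts W ∩ {z}).card = 0 ∧ (pts W ∩ T).card = 0) ∨
        ((pts W ∩ {z}).card = 1 ∧ (pts W ∩ T).card = 0) ∨
        ((pts W ∩ {z}).card = 0 ∧ (pts W ∩ T).card = 1) := by omega
    · exact hasDesign_5_0.hasGDD_weight hzT h3 (by omega)
    · exact hasDesign_4_0.hasGDD_weight hzT h3 (by omega)
    · exact hasDesign_4_1.hasGDD_weight hzT h3 (by omega)
  · refine hbc.hasGDD_weight hzT (by rw [inter_eq_right.2 hTS, hTc]) ?_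
    rw [inter_singleton_of_mem hz, card_singleton]
    omega
  · have := hsum ⊤ le_top
    omega
  · intro _ W hSW hW4
    have h1 := hsum W hSW
    have h2 := card_pts_le hK hW4
    simp [sum_range_succ] at h2
    omega

end Cases

theorem three_mul_bracket4 (d : ℕ) : 3 * bracket4 d + 1 = 4 ^ (d + 1) := by
  unfold bracket4
  induction d with
  | zero => simp
  | succ d ih =>
    rw [sum_range_succ, mul_add, pow_succ 4 (d + 1)]
    omega

/-- The inflation case: for every `d ≥ 3` and every `v` with `[d]₄ ≤ v ≤ 3[d]₄`, if
`v - [d]₄ ∉ {1,3,9}` there is a `PBD(v,{3,4,5})` in which every three points lie in a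
flat of size at most `63`, and if `v - [d]₄ ∈ {1,3,9}` there is one in which every three
points lie in a flat of size at most `94`. -/
theorem statement16 (d : ℕ) (hd : 3 ≤ d) (v : ℕ)
    (h1 : bracket4 d ≤ v) (h2 : v ≤ 3 * bracket4 d) :
    (v - bracket4 d ∉ ({1, 3, 9} : Set ℕ) →
      ∃ Blocks : Finset (Finset (Fin v)), IsPBD Finset.univ ({3, 4, 5} : Set ℕ) Blocks ∧
        ∀ S : Finset (Fin v), S.card = 3 →
          ∃ Y : Finset (Fin v), IsFlat Finset.univ Blocks Y ∧ S ⊆ Y ∧ Y.card ≤ 63) ∧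
    (v - bracket4 d ∈ ({1, 3, 9} : Set ℕ) →
      ∃ Blocks : Finset (Finset (Fin v)), IsPBD Finset.univ ({3, 4, 5} : Set ℕ) Blocks ∧
        ∀ S : Finset (Fin v), S.card = 3 →
          ∃ Y : Finset (Fin v), IsFlat Finset.univ Blocks Y ∧ S ⊆ Y ∧ Y.card ≤ 94) := by
  change (_ → HasSmallFlatPBD v 63) ∧ (_ → HasSmallFlatPBD v 94)
  have : Fact (Nat.Prime 2) := ⟨Nat.prime_two⟩
  let K := GaloisField 2 2
  have hK : Nat.card K = 4 := by simpa using GaloisField.card 2 2 (by norm_num)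
  have : Finite K := Nat.finite_of_card_ne_zero (by omega)
  have hV : ∀ m, finrank K (Fin m → K) = m := fun m => by simp
  have hn : (pts (⊤ : Submodule K (Fin (d + 1) → K))).card = bracket4 d :=
    card_pts_of_finrank hK (by rw [finrank_top, hV])
  have h3 := three_mul_bracket4 d
  have hlarge : 4 ^ (3 + 1) ≤ 4 ^ (d + 1) := Nat.pow_le_pow_right (by norm_num) (by omega)
  simp only [Set.mem_insert_iff, Set.mem_singleton_iff]
  constructor
  · intro hex
    obtain ⟨t, ht | ht⟩ := Nat.even_or_odd' (v - bracket4 d)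
    · have := hasSmallFlatPBD_even (V := Fin (d + 1) → K) hK (t := t) (by omega)
      rwa [hn, ← ht, Nat.add_sub_cancel' h1] at this
    · by_cases ht' : t + 1 = bracket4 d
      · have := hasSmallFlatPBD_affine hK (by omega) (hV (d + 1 + 1))
        rwa [show 4 ^ (d + 1) - 2 = v by omega] at this
      · exact hasSmallFlatPBD_odd (V := Fin (d + 1) → K) hK (t := t + 1) (by omega) (by omega)
          (by omega) (by omega) (by omega)
  · intro hex
    have hrank : 3 ≤ finrank K (Fin (d + 1) → K) := by rw [hV]; omega
    rcases hex with h | h | h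
    · exact hasSmallFlatPBD_exceptional hK hrank hasDesign_19_1 (by norm_num) (by norm_num)
        (by omega)
    · exact hasSmallFlatPBD_exceptional hK hrank hasDesign_18_2 (by norm_num) (by norm_num)
        (by omega)
    · exact hasSmallFlatPBD_exceptional hK hrank hasDesign_15_5 (by norm_num) (by norm_num)
        (by omega)
end

section
/- For every positive integer n there exists a latin square L of order n with the property that for every cell (i,j) and every symbol s, there exist a row set R ∋ i, a column set C ∋ j, and a symbol set S ∋ s forming a subsquare of L of order at most 94. -/
/-- `IsLatinOn B f` : `f` restricts to a latin square with rows, columns and symbols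
indexed by the finite set `B`. -/
def IsLatinOn {X : Type*} (B : Finset X) (f : X → X → X) : Prop :=
  (∀ i ∈ B, Set.BijOn (f i) ↑B ↑B) ∧ ∀ j ∈ B, Set.BijOn (fun i => f i j) ↑B ↑B

/-- `IsSubsquare L R C S` : the rows `R`, columns `C` and symbols `S` form a latin
subsquare of the array `L` : the three sets have equal size, and each row of `R`,
restricted to the columns `C`, hits each symbol of `S` exactly once. -/
def IsSubsquare {X : Type*} (L : X → X → X) (R C S : Finset X) : Prop :=
  R.card = C.card ∧ C.card = S.card ∧ ∀ i ∈ R, Set.BijOn (L i) ↑C ↑S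

open Finset

instance fact_prime_seven : Fact (Nat.Prime 7) := ⟨by norm_num⟩

/-- `z` lies on the affine line over `ZMod 7` through `x` and `y`, and differs from both
whenever they are distinct. -/
def OnLine {W : Type*} [AddCommGroup W] [Module (ZMod 7) W] (x y z : W) : Prop :=
  ∃ t : ZMod 7, t ≠ 0 ∧ t ≠ 1 ∧ z = x + t • (y - x)

/-- `B` carries a latin square in which the points representing row, column and symbol
of each cell are collinear. A set `B` of vectors with `HasLineLatin B id id id` is called
line-closed below. -/
def HasLineLatin {X W : Type*} [AddCommGroup W] [Module (ZMod 7) W]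
    (B : Finset X) (p q s : X → W) : Prop :=
  ∃ f : X → X → X, IsLatinOn B f ∧ ∀ x ∈ B, ∀ y ∈ B, OnLine (p x) (q y) (s (f x y))

lemma isLatinOn_of_injOn {X : Type*} {B : Finset X} {f : X → X → X}
    (hf : ∀ x ∈ B, ∀ y ∈ B, f x y ∈ B)
    (hl : ∀ x ∈ B, ∀ y ∈ B, ∀ y' ∈ B, f x y = f x y' → y = y')
    (hr : ∀ x ∈ B, ∀ x' ∈ B, ∀ y ∈ B, f x y = f x' y → x = x') : IsLatinOn B f := by
  refine ⟨fun x hx => ?_, fun y hy => ?_⟩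
  · have hm : Set.MapsTo (f x) (B : Set X) B := fun y hy => hf x hx y hy
    have hi : Set.InjOn (f x) (B : Set X) := fun y hy y' hy' h => hl x hx y hy y' hy' h
    exact ⟨hm, hi, Finset.surjOn_of_injOn_of_card_le _ hm hi le_rfl⟩
  · have hm : Set.MapsTo (fun x => f x y) (B : Set X) B := fun x hx => hf x hx y hy
    have hi : Set.InjOn (fun x => f x y) (B : Set X) := fun x hx x' hx' h => hr x hx x' hx' y hy h
    exact ⟨hm, hi, Finset.surjOn_of_injOn_of_card_le _ hm hi le_rfl⟩

section OnLine

variable {W : Type*} [AddCommGroup W] [Module (ZMod 7) W] {x y z : W}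

lemma OnLine.sub_mem (h : OnLine x y z) {D : Submodule (ZMod 7) W} {o : W}
    (hx : x - o ∈ D) (hy : y - o ∈ D) : z - o ∈ D := by
  obtain ⟨t, -, -, rfl⟩ := h
  have : x + t • (y - x) - o = (1 - t) • (x - o) + t • (y - o) := by module
  rw [this]
  exact D.add_mem (D.smul_mem _ hx) (D.smul_mem _ hy)

lemma OnLine.swap (h : OnLine x y z) : OnLine y x z := by
  obtain ⟨t, h0, h1, rfl⟩ := h
  refine ⟨1 - t, sub_ne_zero.2 h1.symm, fun h => h0 (by linear_combination -h), by module⟩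

lemma OnLine.rotate (h : OnLine x y z) : OnLine x z y := by
  obtain ⟨t, h0, h1, rfl⟩ := h
  refine ⟨t⁻¹, inv_ne_zero h0, fun h => h1 (inv_eq_one.1 h), ?_⟩
  rw [add_sub_cancel_left, smul_smul, inv_mul_cancel₀ h0]
  module

end OnLine

lemma card_le_of_sub_mem_span_pair {X W : Type*} [AddCommGroup W] [Module (ZMod 7) W]
    (B : Finset X) (p : X → W) (hp : Set.InjOn p B) (o d e : W)
    (h : ∀ x ∈ B, p x - o ∈ Submodule.span (ZMod 7) {d, e}) : B.card ≤ 49 := by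
  classical
  have : (B.image p).card ≤ (univ.image fun t : ZMod 7 × ZMod 7 => o + (t.1 • d + t.2 • e)).card := by
    refine card_le_card fun w hw => ?_
    obtain ⟨x, hx, rfl⟩ := mem_image.1 hw
    obtain ⟨a, b, hab⟩ := Submodule.mem_span_pair.1 (h x hx)
    exact mem_image.2 ⟨(a, b), mem_univ _, by rw [hab]; abel⟩
  rw [card_image_of_injOn hp] at this
  refine this.trans (card_image_le.trans ?_)
  simp

/-- A latin square whose cells are collinear triples is covered by subsquares cut out
by affine planes. -/
lemma HasLineLatin.exists_subsquare {X W : Type*} [AddCommGroup W] [Module (ZMod 7) W]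
    {B : Finset X} {p q s : X → W} (h : HasLineLatin B p q s)
    (hp : Set.InjOn p B) :
    ∃ L : X → X → X, IsLatinOn B L ∧ ∀ i ∈ B, ∀ j ∈ B, ∀ k ∈ B,
      ∃ R C S : Finset X, R ⊆ B ∧ C ⊆ B ∧ S ⊆ B ∧ i ∈ R ∧ j ∈ C ∧ k ∈ S ∧
        IsSubsquare L R C S ∧ R.card ≤ 94 := by
  classical
  obtain ⟨L, hL, hline⟩ := h
  refine ⟨L, hL, fun i hi j hj k hk => ?_⟩
  set D := Submodule.span (ZMod 7) {q j - p i, s k - p i} with hD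
  have hij : q j - p i ∈ D := Submodule.subset_span (by simp)
  have hik : s k - p i ∈ D := Submodule.subset_span (by simp)
  set R := B.filter fun x => p x - p i ∈ D with hR
  set C := B.filter fun x => q x - p i ∈ D with hC
  set S := B.filter fun x => s x - p i ∈ D with hS
  have hiR : i ∈ R := by simp [hR, hi]
  have hjC : j ∈ C := by simp [hC, hj, hij]
  have hkS : k ∈ S := by simp [hS, hk, hik]
  have hrow : ∀ r ∈ R, Set.BijOn (L r) C S := by
    intro r hr
    obtain ⟨hrB, hrD⟩ := mem_filter.1 hr
    refine ⟨fun c hc => ?_, (hL.1 r hrB).injOn.mono (coe_subset.2 (filter_subset _ _)), fun t ht => ?_⟩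
    · obtain ⟨hcB, hcD⟩ := mem_filter.1 hc
      exact mem_filter.2 ⟨(hL.1 r hrB).mapsTo hcB, (hline r hrB c hcB).sub_mem hrD hcD⟩
    · obtain ⟨htB, htD⟩ := mem_filter.1 ht
      obtain ⟨c, hcB, rfl⟩ := (hL.1 r hrB).surjOn htB
      exact ⟨c, mem_filter.2 ⟨hcB, (hline r hrB c hcB).rotate.sub_mem hrD htD⟩, rfl⟩
  have hcol : Set.BijOn (fun r => L r j) R S := by
    refine ⟨fun r hr => (hrow r hr).mapsTo hjC, (hL.2 j hj).injOn.mono (coe_subset.2 (filter_subset _ _)),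
      fun t ht => ?_⟩
    obtain ⟨htB, htD⟩ := mem_filter.1 ht
    obtain ⟨r, hrB, rfl⟩ := (hL.2 j hj).surjOn htB
    exact ⟨r, mem_filter.2 ⟨hrB, (hline r hrB j hj).swap.rotate.sub_mem hij htD⟩, rfl⟩
  have hCS : C.card = S.card := card_bij (fun c _ => L i c) (fun c hc => (hrow i hiR).mapsTo hc)
    (fun a ha b hb h => (hrow i hiR).injOn ha hb h)
    (fun t ht => by
      obtain ⟨c, hc, h⟩ := (hrow i hiR).surjOn ht
      exact ⟨c, hc, h⟩)
  have hRS : R.card = S.card := card_bij (fun r _ => L r j) (fun c hc => hcol.mapsTo hc)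
    (fun a ha b hb h => hcol.injOn ha hb h)
    (fun t ht => by
      obtain ⟨c, hc, h⟩ := hcol.surjOn ht
      exact ⟨c, hc, h⟩)
  refine ⟨R, C, S, filter_subset _ _, filter_subset _ _, filter_subset _ _, hiR, hjC, hkS,
    ⟨hRS.trans hCS.symm, hCS, hrow⟩, ?_⟩
  have := card_le_of_sub_mem_span_pair R p (hp.mono (coe_subset.2 (filter_subset _ _))) (p i) _ _
    (fun x hx => (mem_filter.1 hx).2)
  omega

/-- Gluing construction. The points of class `i` are `{i} × Y i`; as rows, columns and symbols
they sit over the positions `p i`, `q i` and `s i` of a pencil of parallel hyperplanes. Cells in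
the same real class (one with `p i = q i`) are filled by the latin square on `Y i`, all others by
small latin squares indexed by the classes met by the line through the row and the column. -/
lemma hasLineLatin_glue {I V : Type*} [Fintype I] [DecidableEq I] [AddCommGroup V]
    [Module (ZMod 7) V] [Fintype V] [DecidableEq V] (p q s : I → ZMod 7) (Y : I → Finset V)
    (K : Finset I) (hK : ∀ i ∈ K, Y i = univ)
    (hpq : ∀ i j, p i = q j → i = j) (hps : ∀ i k, p i = s k → i = k ∧ p i = q i)
    (hqs : ∀ j k, q j = s k → j = k ∧ p j = q j) (hs : ∀ i, p i = q i → s i = p i)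
    (hreal : ∀ i, p i = q i ∨ i ∈ K)
    (hf : ∀ T, K ⊆ T → ∃ f : I → I → I, IsLatinOn T f ∧ ∀ i ∈ T, p i = q i → f i i = i)
    (hY : ∀ i, p i = q i → HasLineLatin (Y i) id id id) :
    HasLineLatin (univ.filter fun x : I × V => x.2 ∈ Y x.1)
      (fun x => (p x.1, x.2)) (fun x => (q x.1, x.2)) (fun x => (s x.1, x.2)) := by
  have : Nonempty (I → I → I) := ⟨fun i _ => i⟩
  choose! f hfl hfi using hf
  choose! g hgl hgline using hY
  let T : V → V → Finset I := fun a b => univ.filter fun k => a + s k • b ∈ Y k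
  have hmemT : ∀ a b k, k ∈ T a b ↔ a + s k • b ∈ Y k := fun a b k => by simp [T]
  have hKT : ∀ a b, K ⊆ T a b := fun a b k hk => by rw [hmemT, hK k hk]; exact mem_univ _
  let Rel : I × V → I × V → I × V → Prop := fun x y z =>
    (p x.1 = q x.1 ∧ y.1 = x.1 ∧ z = (x.1, g x.1 x.2 y.2)) ∨
    ∃ a b, p x.1 ≠ q y.1 ∧ p x.1 ≠ s z.1 ∧ q y.1 ≠ s z.1 ∧ x.2 = a + p x.1 • b ∧
      y.2 = a + q y.1 • b ∧ z.2 = a + s z.1 • b ∧ x.1 ∈ T a b ∧ y.1 ∈ T a b ∧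
      z.1 = f (T a b) x.1 y.1
  have hex : ∀ x y : I × V, x.2 ∈ Y x.1 → y.2 ∈ Y y.1 → ∃ z : I × V, z.2 ∈ Y z.1 ∧ Rel x y z := by
    rintro ⟨i, x⟩ ⟨j, y⟩ hx hy
    by_cases h : p i = q j
    · obtain rfl := hpq i j h
      exact ⟨(i, g i x y), ((hgl i h).1 x hx).mapsTo hy, Or.inl ⟨h, rfl, rfl⟩⟩
    · have hne : q j - p i ≠ 0 := sub_ne_zero.2 (Ne.symm h)
      set b := (q j - p i)⁻¹ • (y - x) with hb
      set a := x - p i • b with ha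
      have hxa : x = a + p i • b := by rw [ha]; abel
      have hya : y = a + q j • b := by
        have : (q j - p i) • b = y - x := by rw [hb, smul_smul, mul_inv_cancel₀ hne, one_smul]
        rw [ha, sub_add_eq_add_sub, add_sub_assoc, ← sub_smul, this]; abel
      have hiT : i ∈ T a b := by
        rcases hreal i with hi | hi
        · rw [hmemT, hs i hi, ← hxa]; exact hx
        · exact hKT _ _ hi
      have hjT : j ∈ T a b := by
        rcases hreal j with hj | hj
        · rw [hmemT, hs j hj, hj, ← hya]; exact hy
        · exact hKT _ _ hj
      have hlat := hfl _ (hKT a b)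
      have hkT : f (T a b) i j ∈ T a b := (hlat.1 i hiT).mapsTo hjT
      refine ⟨(f (T a b) i j, a + s (f (T a b) i j) • b), (hmemT _ _ _).1 hkT,
        Or.inr ⟨a, b, h, fun hk => ?_, fun hk => ?_, hxa, hya, rfl, hiT, hjT, rfl⟩⟩
      · obtain ⟨hk, hi⟩ := hps _ _ hk
        have := (hlat.1 i hiT).injOn hiT hjT ((hfi _ (hKT a b) i hiT hi).trans hk)
        subst this
        exact h hi
      · obtain ⟨hk, hj⟩ := hqs _ _ hk
        have := (hlat.2 j hjT).injOn hjT hiT ((hfi _ (hKT a b) j hjT hj).trans hk)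
        subst this
        exact h hj
  have hline : ∀ (a b a' b' x z : V) (u v : ZMod 7), u ≠ v → x = a + u • b → x = a' + u • b' →
      z = a + v • b → z = a' + v • b' → a = a' ∧ b = b' := by
    intro a b a' b' x z u v huv h1 h2 h3 h4
    have hb : b = b' := by
      have : (u - v) • (b - b') = 0 := by
        have : (u - v) • (b - b') = (a + u • b) - (a' + u • b') - ((a + v • b) - (a' + v • b')) := by
          module
        rw [this, ← h1, ← h2, ← h3, ← h4]; abel
      exact sub_eq_zero.1 ((smul_eq_zero.1 this).resolve_left (sub_ne_zero.2 huv))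
    subst hb
    exact ⟨add_right_cancel (h1.symm.trans h2), rfl⟩
  choose! F hFY hF using hex
  refine ⟨F, isLatinOn_of_injOn ?_ ?_ ?_, ?_⟩
  · intro x hx y hy
    simp only [mem_filter, mem_univ, true_and] at hx hy ⊢
    exact hFY x y hx hy
  · intro x hx y hy y' hy' h
    simp only [mem_filter, mem_univ, true_and] at hx hy hy'
    have h1 := hF x y hx hy
    have h2 := hF x y' hx hy'
    rw [← h] at h2
    generalize F x y = z at h1 h2
    obtain ⟨i, x⟩ := x
    obtain ⟨j, y⟩ := y
    obtain ⟨j', y'⟩ := y'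
    rcases h1 with ⟨hi, hj, hz⟩ | ⟨a, b, hn1, hn2, hn3, hxa, hya, hza, hiT, hjT, hk⟩ <;>
      rcases h2 with ⟨hi', hj', hz'⟩ | ⟨a', b', hn1', hn2', hn3', hxa', hya', hza', hiT', hjT', hk'⟩
    · simp only at *
      subst hj hj' hz
      have := (Prod.ext_iff.1 hz').2
      exact Prod.ext rfl (((hgl _ hi).1 x hx).injOn hy hy' this)
    · exact absurd (by rw [hz]; exact (hs _ hi).symm) hn2'
    · exact absurd (by rw [hz']; exact (hs _ hi').symm) hn2
    · obtain ⟨rfl, rfl⟩ := hline _ _ _ _ _ _ _ _ hn2 hxa hxa' hza hza'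
      have := ((hfl _ (hKT a b)).1 i hiT).injOn hjT hjT' (hk.symm.trans hk')
      simp only at *
      subst this
      rw [hya, hya']
  · intro x hx x' hx' y hy h
    simp only [mem_filter, mem_univ, true_and] at hx hx' hy
    have h1 := hF x y hx hy
    have h2 := hF x' y hx' hy
    rw [← h] at h2
    generalize F x y = z at h1 h2
    obtain ⟨i, x⟩ := x
    obtain ⟨i', x'⟩ := x'
    obtain ⟨j, y⟩ := y
    rcases h1 with ⟨hi, hj, hz⟩ | ⟨a, b, hn1, hn2, hn3, hxa, hya, hza, hiT, hjT, hk⟩ <;>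
      rcases h2 with ⟨hi', hj', hz'⟩ | ⟨a', b', hn1', hn2', hn3', hxa', hya', hza', hiT', hjT', hk'⟩
    · simp only at *
      subst hj hj' hz
      have := (Prod.ext_iff.1 hz').2
      exact Prod.ext rfl (((hgl _ hi).2 y hy).injOn hx hx' this)
    · refine absurd ?_ hn3'
      simp only at *
      subst hj hz
      exact ((hs _ hi).trans hi).symm
    · refine absurd ?_ hn3
      simp only at *
      subst hj' hz'
      exact ((hs _ hi').trans hi').symm
    · obtain ⟨rfl, rfl⟩ := hline _ _ _ _ _ _ _ _ hn3 hya hya' hza hza'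
      have := ((hfl _ (hKT a b)).2 j hjT).injOn hiT hiT' (hk.symm.trans hk')
      simp only at *
      subst this
      rw [hxa, hxa']
  · intro x hx y hy
    simp only [mem_filter, mem_univ, true_and] at hx hy
    have h1 := hF x y hx hy
    generalize F x y = z at h1
    obtain ⟨i, x⟩ := x
    obtain ⟨j, y⟩ := y
    rcases h1 with ⟨hi, hj, hz⟩ | ⟨a, b, hn1, hn2, hn3, hxa, hya, hza, -, -, -⟩
    · simp only at *
      subst hj hz
      obtain ⟨t, h0, h1, ht⟩ := hgline _ hi x hx y hy
      refine ⟨t, h0, h1, ?_⟩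
      simp only [id] at ht
      simp [ht, hs _ hi, hi]
    · obtain ⟨k, z⟩ := z
      simp only at *
      have hne : q j - p i ≠ 0 := sub_ne_zero.2 (Ne.symm hn1)
      obtain ⟨t, ht⟩ : ∃ t, s k = p i + t * (q j - p i) :=
        ⟨(s k - p i) / (q j - p i), by field_simp; ring⟩
      refine ⟨t, ?_, ?_, Prod.ext ?_ ?_⟩
      · rintro rfl
        exact hn2 (by rw [ht]; ring)
      · rintro rfl
        exact hn3 (by rw [ht]; ring)
      · simpa using ht
      · simp only [Prod.snd_add, Prod.smul_snd, Prod.snd_sub]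
        rw [hza, hxa, hya, ht]
        module

lemma exists_idempotent_fin (n : ℕ) (h3 : 3 ≤ n) (h7 : n ≤ 7) :
    ∃ g : Fin n → Fin n → Fin n, (∀ i, Function.Injective (g i)) ∧
      (∀ j, Function.Injective fun i => g i j) ∧ ∀ i, g i i = i := by
  interval_cases n
  · exact ⟨fun i j => 2 * i + 2 * j, by decide, by decide, by decide⟩
  · exact ⟨![![0, 2, 3, 1], ![3, 1, 0, 2], ![1, 3, 2, 0], ![2, 0, 1, 3]],
      by decide, by decide, by decide⟩
  · exact ⟨fun i j => 3 * i + 3 * j, by decide, by decide, by decide⟩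
  · exact ⟨![![0, 2, 1, 4, 5, 3], ![2, 1, 3, 5, 0, 4], ![4, 5, 2, 0, 3, 1],
      ![1, 4, 5, 3, 2, 0], ![5, 3, 0, 1, 4, 2], ![3, 0, 4, 2, 1, 5]], by decide, by decide, by decide⟩
  · exact ⟨fun i j => 4 * i + 4 * j, by decide, by decide, by decide⟩

lemma exists_idempotent {X : Type*} (B : Finset X) (h3 : 3 ≤ B.card) (h7 : B.card ≤ 7) :
    ∃ f : X → X → X, IsLatinOn B f ∧ ∀ i ∈ B, f i i = i := by
  classical
  obtain ⟨g, hl, hr, hi⟩ := exists_idempotent_fin _ h3 h7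
  let e := B.equivFin
  let f : X → X → X := fun x y =>
    if h : x ∈ B ∧ y ∈ B then (e.symm (g (e ⟨x, h.1⟩) (e ⟨y, h.2⟩)) : X) else x
  have hf : ∀ x (hx : x ∈ B) y (hy : y ∈ B), f x y = e.symm (g (e ⟨x, hx⟩) (e ⟨y, hy⟩)) :=
    fun x hx y hy => dif_pos ⟨hx, hy⟩
  refine ⟨f, isLatinOn_of_injOn ?_ ?_ ?_, ?_⟩
  · intro x hx y hy
    rw [hf x hx y hy]
    exact Subtype.property _
  · intro x hx y hy y' hy' h
    rw [hf x hx y hy, hf x hx y' hy'] at h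
    exact congrArg Subtype.val (e.injective (hl _ (e.symm.injective (Subtype.ext h))))
  · intro x hx x' hx' y hy h
    rw [hf x hx y hy, hf x' hx' y hy] at h
    exact congrArg Subtype.val (e.injective (hr _ (e.symm.injective (Subtype.ext h))))
  · intro x hx
    rw [hf x hx x hx, hi, e.symm_apply_apply]

/-- A finite set of at most seven elements carries a latin square that is idempotent away
from a given element. -/
lemma exists_idempotent_except {X : Type*} [DecidableEq X] (B : Finset X) (g : X) (hg : g ∈ B)
    (h7 : B.card ≤ 7) :
    ∃ f : X → X → X, IsLatinOn B f ∧ ∀ i ∈ B, i ≠ g → f i i = i := by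
  by_cases h3 : 3 ≤ B.card
  · obtain ⟨f, hf, hi⟩ := exists_idempotent B h3 h7
    exact ⟨f, hf, fun i hiB _ => hi i hiB⟩
  · have hpos : 0 < B.card := card_pos.2 ⟨g, hg⟩
    obtain h | h : B.card = 1 ∨ B.card = 2 := by omega
    · obtain ⟨a, rfl⟩ := card_eq_one.1 h
      exact ⟨fun x _ => x, isLatinOn_of_injOn (by simp) (by simp) (by simp), by simp⟩
    · obtain ⟨a, hag, rfl⟩ : ∃ a, a ≠ g ∧ B = {g, a} := by
        obtain ⟨x, y, hxy, rfl⟩ := card_eq_two.1 h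
        rcases mem_insert.1 hg with rfl | hgy
        · exact ⟨y, hxy.symm, rfl⟩
        · obtain rfl := mem_singleton.1 hgy
          exact ⟨x, hxy, pair_comm _ _⟩
      exact ⟨fun x y => if x = y then a else g,
        isLatinOn_of_injOn (by simp; grind) (by simp; grind) (by simp; grind), by simp⟩

lemma hasLineLatin_univ {W : Type*} [AddCommGroup W] [Module (ZMod 7) W] [Fintype W] :
    HasLineLatin (univ : Finset W) id id id := by
  have h4 : (4 : ZMod 7) ≠ 0 := by decide
  have h3 : (1 - 4 : ZMod 7) ≠ 0 := by decide
  refine ⟨fun x y => x + (4 : ZMod 7) • (y - x), isLatinOn_of_injOn (by simp) ?_ ?_,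
    fun x _ y _ => ⟨4, h4, by decide, rfl⟩⟩
  · intro x _ y _ y' _ h
    exact sub_left_injective (smul_right_injective W h4 (add_left_cancel h))
  · intro x _ x' _ y _ h
    have hx : ∀ z : W, z + (4 : ZMod 7) • (y - z) = (4 : ZMod 7) • y + (1 - 4 : ZMod 7) • z :=
      fun z => by module
    simp only [hx] at h
    exact smul_right_injective W h3 (add_left_cancel h)

lemma hasLineLatin_empty {W : Type*} [AddCommGroup W] [Module (ZMod 7) W] :
    HasLineLatin (∅ : Finset W) id id id :=
  ⟨fun x _ => x, isLatinOn_of_injOn (by simp) (by simp) (by simp), by simp⟩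

lemma HasLineLatin.map_inr {W U : Type*} [AddCommGroup W] [Module (ZMod 7) W]
    [AddCommGroup U] [Module (ZMod 7) U] {B : Finset W} (h : HasLineLatin B id id id) :
    HasLineLatin (B.map ⟨fun x => ((0 : U), x), fun _ _ h => (Prod.ext_iff.1 h).2⟩)
      id id id := by
  obtain ⟨f, hf, hline⟩ := h
  refine ⟨fun x y => (0, f x.2 y.2), isLatinOn_of_injOn ?_ ?_ ?_, ?_⟩
  · simp only [mem_map]
    rintro _ ⟨x, hx, rfl⟩ _ ⟨y, hy, rfl⟩
    exact ⟨_, (hf.1 x hx).mapsTo hy, rfl⟩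
  · simp only [mem_map]
    rintro _ ⟨x, hx, rfl⟩ _ ⟨y, hy, rfl⟩ _ ⟨y', hy', rfl⟩ h
    exact Prod.ext rfl ((hf.1 x hx).injOn hy hy' (Prod.ext_iff.1 h).2)
  · simp only [mem_map]
    rintro _ ⟨x, hx, rfl⟩ _ ⟨x', hx', rfl⟩ _ ⟨y, hy, rfl⟩ h
    exact Prod.ext rfl ((hf.2 y hy).injOn hx hx' (Prod.ext_iff.1 h).2)
  · simp only [mem_map]
    rintro _ ⟨x, hx, rfl⟩ _ ⟨y, hy, rfl⟩
    obtain ⟨t, h0, h1, ht⟩ := hline x hx y hy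
    exact ⟨t, h0, h1, Prod.ext (show (0 : U) = 0 + t • (0 - 0) by simp) ht⟩

lemma card_filter_fiber {I V : Type*} [Fintype I] [Fintype V] [DecidableEq V]
    (Y : I → Finset V) :
    (univ.filter fun x : I × V => x.2 ∈ Y x.1).card = ∑ i, (Y i).card := by
  rw [card_filter, Fintype.sum_prod_type]
  simp

/-- Three full parallel hyperplanes together with line-closed subsets of the four others
form a line-closed set. -/
lemma exists_hasLineLatin_of_hyperplanes {V : Type*} [AddCommGroup V] [Module (ZMod 7) V]
    [Fintype V] [DecidableEq V] (Y : Fin 4 → Finset V) (hY : ∀ i, HasLineLatin (Y i) id id id) :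
    ∃ Z : Finset (ZMod 7 × V), HasLineLatin Z id id id ∧
      Z.card = 3 * Fintype.card V + ∑ i, (Y i).card := by
  let Y' : ZMod 7 → Finset V := ![univ, univ, univ, Y 0, Y 1, Y 2, Y 3]
  refine ⟨univ.filter fun x : ZMod 7 × V => x.2 ∈ Y' x.1,
    hasLineLatin_glue id id id Y' {0, 1, 2} ?_ (fun _ _ h => h) (fun _ _ h => ⟨h, rfl⟩)
      (fun _ _ h => ⟨h, rfl⟩) (fun _ _ => rfl) (fun _ => Or.inl rfl) ?_ ?_, ?_⟩
  · simp [Y']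
  · intro T hT
    obtain ⟨f, hf, hi⟩ := exists_idempotent T (card_le_card hT)
      ((card_le_univ T).trans_eq (ZMod.card 7))
    exact ⟨f, hf, fun i hiT _ => hi i hiT⟩
  · intro i _
    change Fin 7 at i
    fin_cases i
    exacts [hasLineLatin_univ, hasLineLatin_univ, hasLineLatin_univ, hY 0, hY 1, hY 2, hY 3]
  · rw [card_filter_fiber]
    change ∑ i : Fin 7, (Y' i).card = _
    rw [Fin.sum_univ_seven, Fin.sum_univ_four]
    change univ.card + univ.card + univ.card + (Y 0).card + (Y 1).card + (Y 2).card + (Y 3).card = _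
    rw [card_univ]
    ring

/-- Prolongation: the addition table of `V` extended by four line-closed subsets of `V`. -/
lemma exists_hasLineLatin_prolongation {V : Type*} [AddCommGroup V] [Module (ZMod 7) V]
    [Fintype V] [DecidableEq V] (Y : Fin 4 → Finset V) (hY : ∀ i, HasLineLatin (Y i) id id id) :
    ∃ (B : Finset (Fin 5 × V)) (p q s : Fin 5 × V → ZMod 7 × V), Function.Injective p ∧
      HasLineLatin B p q s ∧ B.card = Fintype.card V + ∑ i, (Y i).card := by
  let Y' : Fin 5 → Finset V := ![univ, Y 0, Y 1, Y 2, Y 3]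
  let p : Fin 5 → ZMod 7 := ![4, 0, 1, 2, 3]
  let q : Fin 5 → ZMod 7 := ![5, 0, 1, 2, 3]
  let s : Fin 5 → ZMod 7 := ![6, 0, 1, 2, 3]
  have hp : Function.Injective p := by decide
  have hne : ∀ i, p i = q i → i ≠ 0 := by decide
  refine ⟨univ.filter fun x : Fin 5 × V => x.2 ∈ Y' x.1, _, _, _, fun x y h => ?_,
    hasLineLatin_glue p q s Y' {0} ?_ (by decide) (by decide) (by decide) (by decide)
      (by decide) ?_ ?_, ?_⟩
  · exact Prod.ext (hp (Prod.ext_iff.1 h).1) (Prod.ext_iff.1 h).2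
  · simp [Y']
  · intro T hT
    obtain ⟨f, hf, hi⟩ := exists_idempotent_except T 0 (by simpa using hT)
      ((card_le_univ T).trans (by simp))
    exact ⟨f, hf, fun i hiT h => hi i hiT (hne i h)⟩
  · intro i hi
    have := hne i hi
    fin_cases i
    exacts [absurd rfl this, hY 0, hY 1, hY 2, hY 3]
  · rw [card_filter_fiber, Fin.sum_univ_five, Fin.sum_univ_four]
    change univ.card + (Y 0).card + (Y 1).card + (Y 2).card + (Y 3).card = _
    rw [card_univ]
    ring

/-- Every `m ≤ 4 * 7 ^ k` is a sum of the sizes of four line-closed subsets of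
a `k`-dimensional space over `ZMod 7`. -/
lemma exists_four_lineClosed (k : ℕ) :
    ∃ (V : Type) (_ : AddCommGroup V) (_ : Module (ZMod 7) V) (_ : Fintype V),
      Fintype.card V = 7 ^ k ∧ ∀ m ≤ 4 * 7 ^ k, ∃ Y : Fin 4 → Finset V,
        (∀ i, HasLineLatin (Y i) id id id) ∧ ∑ i, (Y i).card = m := by
  classical
  induction k with
  | zero =>
    refine ⟨Fin 0 → ZMod 7, inferInstance, inferInstance, inferInstance, by simp,
      fun m hm => ⟨fun i => if (i : ℕ) < m then univ else ∅,
        fun i => ?_, ?_⟩⟩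
    · dsimp only
      split_ifs
      exacts [hasLineLatin_univ, hasLineLatin_empty]
    simp only [pow_zero, mul_one] at hm
    rw [Fin.sum_univ_four]
    interval_cases m <;> simp
  | succ k ih =>
    obtain ⟨V, _, _, _, hV, hY⟩ := ih
    set N := 7 ^ k with hN
    have hbig : ∀ m, m = 0 ∨ (3 * N ≤ m ∧ m ≤ 7 * N) →
        ∃ Z : Finset (ZMod 7 × V), HasLineLatin Z id id id ∧ Z.card = m := by
      rintro m (rfl | ⟨h3, h7⟩)
      · exact ⟨∅, hasLineLatin_empty, rfl⟩
      · obtain ⟨Y, hYl, hYm⟩ := hY (m - 3 * N) (by omega)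
        obtain ⟨Z, hZ, hZm⟩ := exists_hasLineLatin_of_hyperplanes Y hYl
        exact ⟨Z, hZ, by omega⟩
    refine ⟨ZMod 7 × V, inferInstance, inferInstance, inferInstance, ?_, fun m hm => ?_⟩
    · rw [Fintype.card_prod, ZMod.card, hV, pow_succ, mul_comm]
    · rw [pow_succ, ← hN] at hm
      by_cases hsmall : m ≤ 4 * N
      · obtain ⟨Y, hYl, hYm⟩ := hY m hsmall
        exact ⟨_, fun i => (hYl i).map_inr, by simpa using hYm⟩
      · obtain ⟨c, hc, hcm⟩ : ∃ c : Fin 4 → ℕ,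
            (∀ i, c i = 0 ∨ (3 * N ≤ c i ∧ c i ≤ 7 * N)) ∧ ∑ i, c i = m := by
          suffices ∃ a b c d : ℕ, (a = 0 ∨ (3 * N ≤ a ∧ a ≤ 7 * N)) ∧
              (b = 0 ∨ (3 * N ≤ b ∧ b ≤ 7 * N)) ∧ (c = 0 ∨ (3 * N ≤ c ∧ c ≤ 7 * N)) ∧
              (d = 0 ∨ (3 * N ≤ d ∧ d ≤ 7 * N)) ∧ a + b + c + d = m by
            obtain ⟨a, b, c, d, ha, hb, hc, hd, hm⟩ := this
            refine ⟨![a, b, c, d], fun i => ?_, by simpa [Fin.sum_univ_four] using hm⟩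
            fin_cases i
            exacts [ha, hb, hc, hd]
          obtain h | h | h | h | h | h | h : m ≤ 7 * N ∨ (7 * N < m ∧ m ≤ 10 * N) ∨
            (10 * N < m ∧ m ≤ 14 * N) ∨ (14 * N < m ∧ m ≤ 17 * N) ∨
            (17 * N < m ∧ m ≤ 21 * N) ∨ (21 * N < m ∧ m ≤ 24 * N) ∨ 24 * N < m := by omega
          · exact ⟨m, 0, 0, 0, by omega⟩
          · exact ⟨3 * N, m - 3 * N, 0, 0, by omega⟩
          · exact ⟨7 * N, m - 7 * N, 0, 0, by omega⟩
          · exact ⟨7 * N, 3 * N, m - 10 * N, 0, by omega⟩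
          · exact ⟨7 * N, 7 * N, m - 14 * N, 0, by omega⟩
          · exact ⟨7 * N, 7 * N, 3 * N, m - 17 * N, by omega⟩
          · exact ⟨7 * N, 7 * N, 7 * N, m - 21 * N, by omega⟩
        choose Z hZ hZc using fun i => hbig (c i) (hc i)
        exact ⟨Z, hZ, by simp [hZc, hcm]⟩

/-- Transport of a locally covered latin square to `Fin n`. -/
lemma HasLineLatin.exists_fin {X W : Type*} [AddCommGroup W] [Module (ZMod 7) W]
    {B : Finset X} {p q s : X → W} (h : HasLineLatin B p q s) (hp : Set.InjOn p B)
    {n : ℕ} (hn : B.card = n) :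
    ∃ L : Fin n → Fin n → Fin n,
      (∀ i : Fin n, Function.Bijective (L i)) ∧
      (∀ j : Fin n, Function.Bijective fun i => L i j) ∧
      ∀ i j s : Fin n, ∃ R C S : Finset (Fin n),
        i ∈ R ∧ j ∈ C ∧ s ∈ S ∧ IsSubsquare L R C S ∧ R.card ≤ 94 := by
  classical
  subst hn
  obtain ⟨M, hM, hsub⟩ := h.exists_subsquare hp
  let e : Fin B.card → X := fun i => B.equivFin.symm i
  have heB : ∀ i, e i ∈ B := fun i => Subtype.property _
  have he : Function.Injective e := Subtype.val_injective.comp B.equivFin.symm.injective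
  have hsurj : ∀ x ∈ B, ∃ i, e i = x := fun x hx => ⟨B.equivFin ⟨x, hx⟩, by simp [e]⟩
  choose L hL using fun i j => hsurj _ ((hM.1 (e i) (heB i)).mapsTo (heB j))
  refine ⟨L, fun i => Finite.injective_iff_bijective.1 fun j j' h => ?_,
    fun j => Finite.injective_iff_bijective.1 fun i i' h => ?_, fun i j k => ?_⟩
  · exact he ((hM.1 (e i) (heB i)).injOn (heB j) (heB j') (by rw [← hL, ← hL, h]))
  · refine he ((hM.2 (e j) (heB j)).injOn (heB i) (heB i') ?_)
    rw [← hL, ← hL]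
    exact congrArg e h
  · obtain ⟨R, C, S, hR, hC, hS, hi, hj, hk, ⟨h1, h2, h3⟩, h94⟩ :=
      hsub _ (heB i) _ (heB j) _ (heB k)
    have hcard : ∀ A ⊆ B, (A.preimage e he.injOn).card = A.card := by
      intro A hA
      rw [card_preimage]
      congr 1
      refine filter_true_of_mem fun x hx => ?_
      obtain ⟨i, hi⟩ := hsurj x (hA hx)
      exact ⟨i, hi⟩
    refine ⟨R.preimage e he.injOn, C.preimage e he.injOn, S.preimage e he.injOn,
      by simpa using hi, by simpa using hj, by simpa using hk,
      ⟨by rw [hcard R hR, hcard C hC, h1], by rw [hcard C hC, hcard S hS, h2], fun r hr => ?_⟩,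
      by rwa [hcard R hR]⟩
    have hb := h3 (e r) (by simpa using hr)
    refine ⟨fun c hc => ?_, fun c hc c' hc' h => ?_, fun t ht => ?_⟩
    · have := hb.mapsTo (x := e c) (by simpa using hc)
      simpa [hL] using this
    · exact he (hb.injOn (by simpa using hc) (by simpa using hc') (by rw [← hL, ← hL, h]))
    · obtain ⟨x, hx, hxt⟩ := hb.surjOn (a := e t) (by simpa using ht)
      obtain ⟨c, rfl⟩ := hsurj x (hC hx)
      exact ⟨c, by simpa using hx, he (by rw [hL, hxt])⟩

/-- For every positive integer `n` there is a latin square of order `n` in which every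
cell and every symbol lie together in a latin subsquare of order at most `94`. -/
theorem statement18 (n : ℕ) (hn : 0 < n) :
    ∃ L : Fin n → Fin n → Fin n,
      (∀ i : Fin n, Function.Bijective (L i)) ∧
      (∀ j : Fin n, Function.Bijective fun i => L i j) ∧
      ∀ i j s : Fin n, ∃ R C S : Finset (Fin n),
        i ∈ R ∧ j ∈ C ∧ s ∈ S ∧ IsSubsquare L R C S ∧ R.card ≤ 94 := by
  classical
  set N := 7 ^ Nat.log 7 n with hN
  have hNn : N ≤ n := Nat.pow_log_le_self 7 hn.ne'
  have hnN : n < 7 * N := by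
    have := Nat.lt_pow_succ_log_self (b := 7) (by norm_num) n
    rw [pow_succ] at this
    omega
  obtain ⟨V, _, _, _, hV, hY⟩ := exists_four_lineClosed (Nat.log 7 n)
  by_cases h5 : n ≤ 5 * N
  · obtain ⟨Y, hYl, hYm⟩ := hY (n - N) (by omega)
    obtain ⟨B, p, q, s, hp, hB, hc⟩ := exists_hasLineLatin_prolongation Y hYl
    exact hB.exists_fin hp.injOn (by omega)
  · obtain ⟨Y, hYl, hYm⟩ := hY (n - 3 * N) (by omega)
    obtain ⟨Z, hZ, hc⟩ := exists_hasLineLatin_of_hyperplanes Y hYl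
    exact hZ.exists_fin Function.injective_id.injOn (by omega)
end
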